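/- arXiv:1902.00013 — 3 statements merged into one kernel-verified Lean document; each statement's English description precedes it below -/
import Mathlib

section
/- Let 𝒢 be an ultragraph such that s⁻¹(v) is finite or countable for each v ∈ G⁰ and r(e) is finite or countable for each e ∈ 𝒢¹, and let R be a nontrivial unital commutative ring. Then there exists a 𝒢-algebraic branching system {R_e, D_A, f_e}_{e∈𝒢¹, A∈𝒢⁰} on a set X such that the induced representation π : L_R(𝒢) → Hom_R(M) is injective. -/
universe u v w

/-- An ultragraph `𝒢 = (G⁰, 𝒢¹, r, s)`: a set of vertices `V`, a set of edges `E`,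
a source map `s : E → V` and a range map `r : E → P(V) ∖ {∅}`. -/
structure Ultragraph (V : Type u) (E : Type v) where
  s : E → V
  r : E → Set V
  r_nonempty : ∀ e, (r e).Nonempty

namespace Ultragraph

variable {V : Type u} {E : Type v}

/-- The collection `𝒢⁰` of generalized vertices: the smallest collection of subsets of `V`
containing all singletons and all ranges, closed under finite unions and intersections
(it contains the empty set). -/
inductive IsG0 (G : Ultragraph V E) : Set V → Prop
  | empty : IsG0 G ∅
  | singleton (v : V) : IsG0 G {v}
  | range (e : E) : IsG0 G (G.r e)
  | union {A B : Set V} : IsG0 G A → IsG0 G B → IsG0 G (A ∪ B)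
  | inter {A B : Set V} : IsG0 G A → IsG0 G B → IsG0 G (A ∩ B)

/-- `𝒢⁰` as a type. -/
def G0 (G : Ultragraph V E) : Type u := {A : Set V // G.IsG0 A}

def vtx (G : Ultragraph V E) (v : V) : G.G0 := ⟨{v}, IsG0.singleton v⟩

def rng (G : Ultragraph V E) (e : E) : G.G0 := ⟨G.r e, IsG0.range e⟩

def emptyG0 (G : Ultragraph V E) : G.G0 := ⟨∅, IsG0.empty⟩

def interG0 (G : Ultragraph V E) (A B : G.G0) : G.G0 := ⟨A.1 ∩ B.1, A.2.inter B.2⟩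

def unionG0 (G : Ultragraph V E) (A B : G.G0) : G.G0 := ⟨A.1 ∪ B.1, A.2.union B.2⟩

/-- Generators of the ultragraph Leavitt path algebra: edges `s_e`, ghost edges `s_e*`,
and projections `p_A` for `A ∈ 𝒢⁰`. -/
inductive LGen (G : Ultragraph V E) : Type max u v
  | edge (e : E) : LGen G
  | ghost (e : E) : LGen G
  | proj (A : G.G0) : LGen G

/-- The defining relations of the ultragraph Leavitt path algebra, as a relation on the
free `R`-algebra on the generators. -/
inductive LeavittRel (R : Type w) [CommRing R] (G : Ultragraph V E) :
    FreeAlgebra R (LGen G) → FreeAlgebra R (LGen G) → Prop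
  | p_empty :
      LeavittRel R G (FreeAlgebra.ι R (LGen.proj G.emptyG0)) 0
  | p_mul (A B : G.G0) :
      LeavittRel R G (FreeAlgebra.ι R (LGen.proj A) * FreeAlgebra.ι R (LGen.proj B))
        (FreeAlgebra.ι R (LGen.proj (G.interG0 A B)))
  | p_union (A B : G.G0) :
      LeavittRel R G (FreeAlgebra.ι R (LGen.proj (G.unionG0 A B)))
        (FreeAlgebra.ι R (LGen.proj A) + FreeAlgebra.ι R (LGen.proj B)
          - FreeAlgebra.ι R (LGen.proj (G.interG0 A B)))
  | src_edge (e : E) :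
      LeavittRel R G
        (FreeAlgebra.ι R (LGen.proj (G.vtx (G.s e))) * FreeAlgebra.ι R (LGen.edge e))
        (FreeAlgebra.ι R (LGen.edge e))
  | edge_rng (e : E) :
      LeavittRel R G
        (FreeAlgebra.ι R (LGen.edge e) * FreeAlgebra.ι R (LGen.proj (G.rng e)))
        (FreeAlgebra.ι R (LGen.edge e))
  | rng_ghost (e : E) :
      LeavittRel R G
        (FreeAlgebra.ι R (LGen.proj (G.rng e)) * FreeAlgebra.ι R (LGen.ghost e))
        (FreeAlgebra.ι R (LGen.ghost e))
  | ghost_src (e : E) :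
      LeavittRel R G
        (FreeAlgebra.ι R (LGen.ghost e) * FreeAlgebra.ι R (LGen.proj (G.vtx (G.s e))))
        (FreeAlgebra.ι R (LGen.ghost e))
  | ghost_edge_ne {e f : E} (h : e ≠ f) :
      LeavittRel R G (FreeAlgebra.ι R (LGen.ghost e) * FreeAlgebra.ι R (LGen.edge f)) 0
  | ghost_edge (e : E) :
      LeavittRel R G (FreeAlgebra.ι R (LGen.ghost e) * FreeAlgebra.ι R (LGen.edge e))
        (FreeAlgebra.ι R (LGen.proj (G.rng e)))
  | ck (v : V) (hfin : {e : E | G.s e = v}.Finite) (hne : {e : E | G.s e = v}.Nonempty) :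
      LeavittRel R G (FreeAlgebra.ι R (LGen.proj (G.vtx v)))
        (∑ e ∈ hfin.toFinset, FreeAlgebra.ι R (LGen.edge e) * FreeAlgebra.ι R (LGen.ghost e))

/-- The ultragraph Leavitt path algebra `L_R(𝒢)`. -/
def LeavittAlgebra (R : Type w) [CommRing R] (G : Ultragraph V E) : Type max u v w :=
  RingQuot (LeavittRel R G)

instance (R : Type w) [CommRing R] (G : Ultragraph V E) : Ring (LeavittAlgebra R G) :=
  inferInstanceAs (Ring (RingQuot (LeavittRel R G)))

instance (R : Type w) [CommRing R] (G : Ultragraph V E) : Algebra R (LeavittAlgebra R G) :=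
  inferInstanceAs (Algebra R (RingQuot (LeavittRel R G)))

/-- The projection `p_A ∈ L_R(𝒢)`, for `A ∈ 𝒢⁰`. -/
def Pg (G : Ultragraph V E) (R : Type w) [CommRing R] (A : G.G0) : LeavittAlgebra R G :=
  RingQuot.mkAlgHom R (LeavittRel R G) (FreeAlgebra.ι R (LGen.proj A))

/-- The element `s_e ∈ L_R(𝒢)`. -/
def Se (G : Ultragraph V E) (R : Type w) [CommRing R] (e : E) : LeavittAlgebra R G :=
  RingQuot.mkAlgHom R (LeavittRel R G) (FreeAlgebra.ι R (LGen.edge e))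

/-- The element `s_e* ∈ L_R(𝒢)`. -/
def St (G : Ultragraph V E) (R : Type w) [CommRing R] (e : E) : LeavittAlgebra R G :=
  RingQuot.mkAlgHom R (LeavittRel R G) (FreeAlgebra.ι R (LGen.ghost e))

/-- For a finite path `c = c₁ ⋯ c_k`, the element `s_c = s_{c₁} ⋯ s_{c_k}`
(the empty product for the empty list). -/
def Sp (G : Ultragraph V E) (R : Type w) [CommRing R] (c : List E) : LeavittAlgebra R G :=
  (c.map (G.Se R)).prod

/-- A (finite, nonempty) path in the ultragraph. -/
def IsPath (G : Ultragraph V E) (c : List E) : Prop :=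
  c ≠ [] ∧ c.Chain' (fun e f => G.s f ∈ G.r e)

/-- A closed path: a path with `s(c₁) ∈ r(c_k)`. -/
def IsClosedPath (G : Ultragraph V E) (c : List E) : Prop :=
  ∃ h : G.IsPath c, G.s (c.head h.1) ∈ G.r (c.getLast h.1)

/-- A cycle: a closed path whose edges have pairwise distinct sources. -/
def IsCycle (G : Ultragraph V E) (c : List E) : Prop :=
  G.IsClosedPath c ∧ c.Pairwise (fun e f => G.s e ≠ G.s f)

/-- A sink: a vertex emitting no edges. -/
def IsSink (G : Ultragraph V E) (v : V) : Prop := ∀ e, G.s e ≠ v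

/-- An exit for a closed path `c`: an edge `f` with `s(f) ∈ r(c_i)` and `f ≠ c_{i+1}`
(indices cyclic), or a sink in some `r(c_i)`. -/
def HasExit (G : Ultragraph V E) (c : List E) : Prop :=
  (∃ (f : E) (i : Fin c.length), G.s f ∈ G.r (c.get i) ∧
      f ≠ c.get ⟨(i.1 + 1) % c.length, Nat.mod_lt _ i.pos⟩) ∨
  (∃ (w : V) (i : Fin c.length), G.IsSink w ∧ w ∈ G.r (c.get i))

/-- Condition (L): every closed path has an exit. -/
def ConditionL (G : Ultragraph V E) : Prop :=
  ∀ c : List E, G.IsClosedPath c → G.HasExit c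

/-- The range `r(c)` of a finite path `c` (the range of its last edge). -/
def pathRange (G : Ultragraph V E) (c : List E) : Set V :=
  (c.getLast?.map G.r).getD ∅

theorem isG0_pathRange (G : Ultragraph V E) (c : List E) : G.IsG0 (G.pathRange c) := by
  unfold pathRange
  cases c.getLast? with
  | none => exact IsG0.empty
  | some e => exact IsG0.range e

/-- The range of a path, as an element of `𝒢⁰`. -/
def pathRng (G : Ultragraph V E) (c : List E) : G.G0 :=
  ⟨G.pathRange c, G.isG0_pathRange c⟩

end Ultragraph
namespace Ultragraph

open scoped Classical

variable {V : Type u} {E : Type v}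

/-- A `𝒢`-algebraic branching system on a set `X`. -/
structure BranchingSystem (G : Ultragraph V E) (X : Type*) where
  Re : E → Set X
  D : G.G0 → Set X
  disj : ∀ ⦃e f : E⦄, e ≠ f → Re e ∩ Re f = ∅
  D_empty : D G.emptyG0 = ∅
  D_inter : ∀ A B : G.G0, D A ∩ D B = D (G.interG0 A B)
  D_union : ∀ A B : G.G0, D A ∪ D B = D (G.unionG0 A B)
  Re_subset : ∀ e : E, Re e ⊆ D (G.vtx (G.s e))
  D_vtx : ∀ v : V, {e : E | G.s e = v}.Finite → {e : E | G.s e = v}.Nonempty →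
    D (G.vtx v) = ⋃ e ∈ {e : E | G.s e = v}, Re e
  fe : ∀ e : E, ↥(D (G.rng e)) ≃ ↥(Re e)

namespace BranchingSystem

variable {G : Ultragraph V E} {X : Type*}

/-- The extension of `f_e : D_{r(e)} → R_e` to a function `X → X` (identity elsewhere). -/
noncomputable def tot (B : BranchingSystem G X) (e : E) : X → X := fun x =>
  if h : x ∈ B.D (G.rng e) then (B.fe e ⟨x, h⟩ : X) else x

/-- For a path `c = c₁ ⋯ c_k`, the composite `f_c = f_{c₁} ∘ ⋯ ∘ f_{c_k}` (extended). -/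
noncomputable def pathMap (B : BranchingSystem G X) (c : List E) : X → X :=
  c.foldr (fun e g => B.tot e ∘ g) id

end BranchingSystem

/-- `π : L_R(𝒢) → Hom_R(M)`, with `M` the module of all functions `X → R`, is the
representation induced by the branching system `B` if it satisfies the defining formulas
`π(s_e)(φ) = (φ ∘ f_e⁻¹)·1_{R_e}`, `π(s_e*)(φ) = (φ ∘ f_e)·1_{D_{r(e)}}`,
`π(p_A)(φ) = 1_{D_A}·φ`. -/
def IsInducedRep (G : Ultragraph V E) (R : Type w) [CommRing R] {X : Type*}
    (B : BranchingSystem G X)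
    (π : LeavittAlgebra R G →ₐ[R] Module.End R (X → R)) : Prop :=
  (∀ (e : E) (φ : X → R) (x : X),
      π (G.Se R e) φ x = if h : x ∈ B.Re e then φ ((B.fe e).symm ⟨x, h⟩ : X) else 0) ∧
  (∀ (e : E) (φ : X → R) (x : X),
      π (G.St R e) φ x = if h : x ∈ B.D (G.rng e) then φ ((B.fe e ⟨x, h⟩ : X)) else 0) ∧
  (∀ (A : G.G0) (φ : X → R) (x : X),
      π (G.Pg R A) φ x = if x ∈ B.D A then φ x else 0)

/-- The analogue of `IsInducedRep` for the module of finitely supported functions `X →₀ R`. -/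
def IsInducedRepF (G : Ultragraph V E) (R : Type w) [CommRing R] {X : Type*}
    (B : BranchingSystem G X)
    (π : LeavittAlgebra R G →ₐ[R] Module.End R (X →₀ R)) : Prop :=
  (∀ (e : E) (φ : X →₀ R) (x : X),
      π (G.Se R e) φ x = if h : x ∈ B.Re e then φ ((B.fe e).symm ⟨x, h⟩ : X) else 0) ∧
  (∀ (e : E) (φ : X →₀ R) (x : X),
      π (G.St R e) φ x = if h : x ∈ B.D (G.rng e) then φ ((B.fe e ⟨x, h⟩ : X)) else 0) ∧
  (∀ (A : G.G0) (φ : X →₀ R) (x : X),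
      π (G.Pg R A) φ x = if x ∈ B.D A then φ x else 0)

section Representations

variable (G : Ultragraph V E) (R : Type w) [CommRing R]
variable {N : Type*} [AddCommGroup N] [Module R N]

/-- `S` is a basis of the submodule `W`: it is contained in `W`, linearly independent,
and spans `W`. -/
def IsBasisOf (S : Set N) (W : Submodule R N) : Prop :=
  S ⊆ (W : Set N) ∧ LinearIndependent R ((↑) : S → N) ∧ Submodule.span R S = W

/-- The submodule `N_v = π(p_v)(N)`. -/
def NvSub (π : LeavittAlgebra R G →ₐ[R] Module.End R N) (v : V) : Submodule R N :=
  LinearMap.range (π (G.Pg R (G.vtx v)))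

/-- The submodule `N_{r(e)} = π(p_{r(e)})(N)`. -/
def NreSub (π : LeavittAlgebra R G →ₐ[R] Module.End R N) (e : E) : Submodule R N :=
  LinearMap.range (π (G.Pg R (G.rng e)))

/-- The submodule `N_A = π(p_A)(N)`. -/
def NASub (π : LeavittAlgebra R G →ₐ[R] Module.End R N) (A : G.G0) : Submodule R N :=
  LinearMap.range (π (G.Pg R A))

/-- The submodule `N_e = π(s_e s_e*)(N)`. -/
def NeSub (π : LeavittAlgebra R G →ₐ[R] Module.End R N) (e : E) : Submodule R N :=
  LinearMap.range (π (G.Se R e * G.St R e))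

/-- The data exhibiting a representation `π : L_R(𝒢) → Hom_R(N)` as permutative:
bases `B` of `N`, `B_v` of `N_v`, `B_{r(e)}` of `N_{r(e)}`, `B_e` of `N_e` with
`B_v, B_{r(e)} ⊆ B`, `B_v ⊆ B_{r(e)}` for `v ∈ r(e)`, `B_e ⊆ B_{s(e)}`, and
`π(s_e)(B_{r(e)}) = B_e`. -/
structure PermutativeData (π : LeavittAlgebra R G →ₐ[R] Module.End R N) where
  B : Set N
  Bv : V → Set N
  Br : E → Set N
  Be : E → Set N
  hB : LinearIndependent R ((↑) : B → N) ∧ Submodule.span R B = ⊤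
  hBv : ∀ v : V, IsBasisOf R (Bv v) (NvSub G R π v)
  hBr : ∀ e : E, IsBasisOf R (Br e) (NreSub G R π e)
  hBe : ∀ e : E, IsBasisOf R (Be e) (NeSub G R π e)
  hBvB : ∀ v : V, Bv v ⊆ B
  hBrB : ∀ e : E, Br e ⊆ B
  hBvBr : ∀ (e : E) (v : V), v ∈ G.r e → Bv v ⊆ Br e
  hBeBv : ∀ e : E, Be e ⊆ Bv (G.s e)
  hmap : ∀ e : E, (π (G.Se R e)) '' (Br e) = Be e

/-- A representation is permutative if such data exists. -/
def IsPermutative (π : LeavittAlgebra R G →ₐ[R] Module.End R N) : Prop :=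
  Nonempty (PermutativeData G R π)

end Representations

/-- A description of `A ∈ 𝒢⁰` as `(⋂_{e∈X₁} r(e)) ∪ ⋯ ∪ (⋂_{e∈Xₙ} r(e)) ∪ F`
with each `Xᵢ` a nonempty finite set of edges and `F` a finite set of vertices. -/
structure G0Desc (G : Ultragraph V E) (A : Set V) where
  n : ℕ
  Xs : Fin n → Finset E
  hXs : ∀ i, (Xs i).Nonempty
  F : Finset V
  eq : A = (⋃ i, ⋂ e ∈ (Xs i : Set E), G.r e) ∪ (F : Set V)

/-- The set `B_A` associated to a description of `A ∈ 𝒢⁰` and permutative data. -/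
def BAset {G : Ultragraph V E} (R : Type w) [CommRing R]
    {N : Type*} [AddCommGroup N] [Module R N]
    {π : LeavittAlgebra R G →ₐ[R] Module.End R N}
    (P : PermutativeData G R π) {A : Set V} (d : G0Desc G A) : Set N :=
  (⋃ i, ⋂ e ∈ (d.Xs i : Set E), P.Br e) ∪ ⋃ v ∈ (d.F : Set V), P.Bv v

end Ultragraph
namespace Ultragraph

variable {V : Type u} {E : Type v}

/-! ### Extreme vertices and the iterated construction `𝔾ₙ`, `Xₙ`, `Yₙ`, `Iₙ`

A sub-ultragraph is recorded as a pair `(W, Ed)` of a set of remaining vertices and a set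
of remaining edges; ranges are intersected with `W`. -/

/-- `e` is the extreme edge of the extreme vertex `A = r(e) ∩ W` of the sub-ultragraph
`(W, Ed)`: `r(e)` meets no other range and no source. -/
def IsExtremeRangeEdge (G : Ultragraph V E) (W : Set V) (Ed : Set E) (e : E) : Prop :=
  e ∈ Ed ∧ (∀ f ∈ Ed, f ≠ e → (G.r e ∩ W) ∩ (G.r f ∩ W) = ∅) ∧
    (∀ f ∈ Ed, G.s f ∉ G.r e ∩ W)

/-- `e` is the extreme edge of the extreme vertex `A = {s(e)}` of the sub-ultragraph
`(W, Ed)`: `s(e)` is the source of no other edge and lies in no range. -/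
def IsExtremeSourceEdge (G : Ultragraph V E) (W : Set V) (Ed : Set E) (e : E) : Prop :=
  e ∈ Ed ∧ G.s e ∈ W ∧ (∀ f ∈ Ed, f ≠ e → G.s f ≠ G.s e) ∧
    (∀ f ∈ Ed, G.s e ∉ G.r f ∩ W)

/-- The set of extreme vertices of the sub-ultragraph `(W, Ed)`. -/
def ExtremeVertSets (G : Ultragraph V E) (W : Set V) (Ed : Set E) : Set (Set V) :=
  {A | (∃ e, G.IsExtremeRangeEdge W Ed e ∧ A = G.r e ∩ W) ∨
    (∃ e, G.IsExtremeSourceEdge W Ed e ∧ A = {G.s e})}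

/-- The set of extreme edges of the sub-ultragraph `(W, Ed)`. -/
def ExtremeEdges (G : Ultragraph V E) (W : Set V) (Ed : Set E) : Set E :=
  {e | G.IsExtremeRangeEdge W Ed e ∨ G.IsExtremeSourceEdge W Ed e}

/-- The isolated vertices of the sub-ultragraph `(W, Ed)`: vertices of `W` lying in no
range and being no source. -/
def Isolated (G : Ultragraph V E) (W : Set V) (Ed : Set E) : Set V :=
  {v ∈ W | (∀ e ∈ Ed, v ∉ G.r e) ∧ (∀ e ∈ Ed, G.s e ≠ v)}

/-- `stage G n` is the sub-ultragraph `𝔾ₙ`; `stage G 0 = 𝔾₀` is obtained from `𝒢` by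
removing the isolated vertices, and `𝔾ₙ₊₁` is obtained from `𝔾ₙ` by removing the extreme
vertices `X̄ₙ₊₁`, the extreme edges `Yₙ₊₁`, and then the resulting isolated vertices
`Iₙ₊₁`. -/
def stage (G : Ultragraph V E) : ℕ → Set V × Set E
  | 0 => ({w | w ∈ (⋃ e : E, G.r e) ∪ Set.range G.s}, Set.univ)
  | n + 1 =>
      let p := stage G n
      let W' := p.1 \ ⋃₀ G.ExtremeVertSets p.1 p.2
      let Ed' := p.2 \ G.ExtremeEdges p.1 p.2
      (W' \ G.Isolated W' Ed', Ed')

/-- `XStep G n` is the set `Xₙ₊₁` of extreme vertices of `𝔾ₙ`. -/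
def XStep (G : Ultragraph V E) (n : ℕ) : Set (Set V) :=
  G.ExtremeVertSets (G.stage n).1 (G.stage n).2

/-- `XbarStep G n` is `X̄ₙ₊₁ = ⋃_{A ∈ Xₙ₊₁} A`. -/
def XbarStep (G : Ultragraph V E) (n : ℕ) : Set V := ⋃₀ G.XStep n

/-- `IStep G n` is the set `Iₙ₊₁` of isolated vertices of the ultragraph obtained from
`𝔾ₙ` by removing `X̄ₙ₊₁` and `Yₙ₊₁`. -/
def IStep (G : Ultragraph V E) (n : ℕ) : Set V :=
  G.Isolated ((G.stage n).1 \ G.XbarStep n)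
    ((G.stage n).2 \ G.ExtremeEdges (G.stage n).1 (G.stage n).2)

end Ultragraph

namespace Ultragraph
namespace Faithful

open scoped Classical

section Ops

variable {V : Type u} {E : Type v} {G : Ultragraph V E} {X : Type*} (R : Type w) [CommRing R]

/-- The operator of `s_e`. -/
noncomputable def opS (B : BranchingSystem G X) (e : E) : Module.End R (X → R) where
  toFun φ x := if h : x ∈ B.Re e then φ ((B.fe e).symm ⟨x, h⟩ : X) else 0
  map_add' φ ψ := by
    funext x
    simp only [Pi.add_apply]
    split_ifs <;> simp
  map_smul' c φ := by
    funext x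
    simp only [Pi.smul_apply, RingHom.id_apply]
    split_ifs <;> simp

/-- The operator of `s_e*`. -/
noncomputable def opT (B : BranchingSystem G X) (e : E) : Module.End R (X → R) where
  toFun φ x := if h : x ∈ B.D (G.rng e) then φ ((B.fe e ⟨x, h⟩ : X)) else 0
  map_add' φ ψ := by
    funext x
    simp only [Pi.add_apply]
    split_ifs <;> simp
  map_smul' c φ := by
    funext x
    simp only [Pi.smul_apply, RingHom.id_apply]
    split_ifs <;> simp

/-- The operator of `p_A`. -/
noncomputable def opP (B : BranchingSystem G X) (A : G.G0) : Module.End R (X → R) where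
  toFun φ x := if x ∈ B.D A then φ x else 0
  map_add' φ ψ := by
    funext x
    simp only [Pi.add_apply]
    split_ifs <;> simp
  map_smul' c φ := by
    funext x
    simp only [Pi.smul_apply, RingHom.id_apply]
    split_ifs <;> simp

theorem opS_apply (B : BranchingSystem G X) (e : E) (φ : X → R) (x : X) :
    opS R B e φ x = if h : x ∈ B.Re e then φ ((B.fe e).symm ⟨x, h⟩ : X) else 0 := rfl

theorem opT_apply (B : BranchingSystem G X) (e : E) (φ : X → R) (x : X) :
    opT R B e φ x = if h : x ∈ B.D (G.rng e) then φ ((B.fe e ⟨x, h⟩ : X)) else 0 := rfl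

theorem opP_apply (B : BranchingSystem G X) (A : G.G0) (φ : X → R) (x : X) :
    opP R B A φ x = if x ∈ B.D A then φ x else 0 := rfl

theorem opST_apply (B : BranchingSystem G X) (e : E) (φ : X → R) (x : X) :
    (opS R B e * opT R B e) φ x = if x ∈ B.Re e then φ x else 0 := by
  rw [Module.End.mul_apply, opS_apply]
  by_cases h : x ∈ B.Re e
  · simp [h, opT_apply]
  · simp [h]

/-- Images of the generators. -/
noncomputable def genOp (B : BranchingSystem G X) : LGen G → Module.End R (X → R)
  | LGen.edge e => opS R B e
  | LGen.ghost e => opT R B e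
  | LGen.proj A => opP R B A

theorem rel_ok (B : BranchingSystem G X) ⦃x y : FreeAlgebra R (LGen G)⦄
    (h : LeavittRel R G x y) :
    FreeAlgebra.lift R (genOp R B) x = FreeAlgebra.lift R (genOp R B) y := by
  cases h with
  | p_empty =>
    ext φ x
    simp [genOp, opP_apply, B.D_empty]
  | p_mul A A' =>
    ext φ x
    simp only [map_mul, FreeAlgebra.lift_ι_apply, genOp, Module.End.mul_apply, opP_apply,
      ← B.D_inter, Set.mem_inter_iff]
    split_ifs <;> simp_all
  | p_union A A' =>
    ext φ x
    simp only [map_add, map_sub, FreeAlgebra.lift_ι_apply, genOp, LinearMap.add_apply,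
      LinearMap.sub_apply, Pi.add_apply, Pi.sub_apply, opP_apply,
      ← B.D_inter, ← B.D_union, Set.mem_inter_iff, Set.mem_union]
    by_cases h1 : x ∈ B.D A <;> by_cases h2 : x ∈ B.D A' <;> simp [h1, h2]
  | src_edge e =>
    ext φ x
    simp only [map_mul, FreeAlgebra.lift_ι_apply, genOp, Module.End.mul_apply, opP_apply,
      opS_apply]
    by_cases h : x ∈ B.Re e
    · simp [h, B.Re_subset e h]
    · simp [h]
  | edge_rng e =>
    ext φ x
    simp only [map_mul, FreeAlgebra.lift_ι_apply, genOp, Module.End.mul_apply, opP_apply,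
      opS_apply]
    by_cases h : x ∈ B.Re e
    · simp [h]
    · simp [h]
  | rng_ghost e =>
    ext φ x
    simp only [map_mul, FreeAlgebra.lift_ι_apply, genOp, Module.End.mul_apply, opP_apply,
      opT_apply]
    split_ifs <;> simp
  | ghost_src e =>
    ext φ x
    simp only [map_mul, FreeAlgebra.lift_ι_apply, genOp, Module.End.mul_apply, opP_apply,
      opT_apply]
    by_cases h : x ∈ B.D (G.rng e)
    · simp [h, B.Re_subset e (B.fe e ⟨x, h⟩).2]
    · simp [h]
  | @ghost_edge_ne e f hne =>
    ext φ x
    simp only [map_mul, FreeAlgebra.lift_ι_apply, genOp, Module.End.mul_apply, opS_apply,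
      opT_apply, map_zero]
    by_cases h : x ∈ B.D (G.rng e)
    · have h1 : (B.fe e ⟨x, h⟩ : X) ∉ B.Re f := fun h2 => by
        have : (B.fe e ⟨x, h⟩ : X) ∈ B.Re e ∩ B.Re f := ⟨(B.fe e ⟨x, h⟩).2, h2⟩
        rw [B.disj hne] at this
        exact this
      simp [h, h1]
    · simp [h]
  | ghost_edge e =>
    ext φ x
    simp only [map_mul, FreeAlgebra.lift_ι_apply, genOp, Module.End.mul_apply, opS_apply,
      opT_apply, opP_apply]
    by_cases h : x ∈ B.D (G.rng e)
    · simp [h]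
    · simp [h]
  | ck v hfin hne =>
    ext φ x
    simp only [map_mul, map_sum, FreeAlgebra.lift_ι_apply, genOp, LinearMap.sum_apply,
      Finset.sum_apply, opST_apply, opP_apply]
    by_cases h : x ∈ B.D (G.vtx v)
    · rw [if_pos h]
      have h' := h
      rw [B.D_vtx v hfin hne] at h'
      simp only [Set.mem_iUnion] at h'
      obtain ⟨e, he, hx⟩ := h'
      rw [Finset.sum_eq_single e]
      · simp [hx]
      · intro f _ hf
        have : x ∉ B.Re f := fun h2 => by
          have : x ∈ B.Re f ∩ B.Re e := ⟨h2, hx⟩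
          rw [B.disj hf] at this
          exact this
        simp [this]
      · intro h3
        exact absurd (by simpa using he) h3
    · rw [if_neg h]
      symm
      apply Finset.sum_eq_zero
      intro e he
      have he : G.s e = v := by simpa using he
      have : x ∉ B.Re e := fun h2 => h (he ▸ B.Re_subset e h2)
      simp [this]

/-- The induced representation. -/
noncomputable def rep (B : BranchingSystem G X) :
    LeavittAlgebra R G →ₐ[R] Module.End R (X → R) :=
  RingQuot.liftAlgHom R ⟨FreeAlgebra.lift R (genOp R B), rel_ok R B⟩

theorem rep_mk (B : BranchingSystem G X) (z : FreeAlgebra R (LGen G)) :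
    rep R B (RingQuot.mkAlgHom R (LeavittRel R G) z) = FreeAlgebra.lift R (genOp R B) z :=
  RingQuot.liftAlgHom_mkAlgHom_apply _ _ _ _

theorem rep_Se (B : BranchingSystem G X) (e : E) : rep R B (G.Se R e) = opS R B e := by
  rw [Se, rep_mk, FreeAlgebra.lift_ι_apply]; rfl

theorem rep_St (B : BranchingSystem G X) (e : E) : rep R B (G.St R e) = opT R B e := by
  rw [St, rep_mk, FreeAlgebra.lift_ι_apply]; rfl

theorem rep_Pg (B : BranchingSystem G X) (A : G.G0) : rep R B (G.Pg R A) = opP R B A := by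
  rw [Pg, rep_mk, FreeAlgebra.lift_ι_apply]; rfl

theorem rep_induced (B : BranchingSystem G X) : IsInducedRep G R B (rep R B) := by
  refine ⟨fun e φ x => ?_, fun e φ x => ?_, fun A φ x => ?_⟩
  · rw [rep_Se]; rfl
  · rw [rep_St]; rfl
  · rw [rep_Pg]; rfl

end Ops

section Alg

variable {V : Type u} {E : Type v} (G : Ultragraph V E) (R : Type w) [CommRing R]

/-- The quotient map. -/
noncomputable def mk : FreeAlgebra R (LGen G) →ₐ[R] LeavittAlgebra R G :=
  RingQuot.mkAlgHom R (LeavittRel R G)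

theorem mk_surj : Function.Surjective (mk G R) := RingQuot.mkAlgHom_surjective R _

theorem mk_rel {x y : FreeAlgebra R (LGen G)} (h : LeavittRel R G x y) :
    mk G R x = mk G R y := RingQuot.mkAlgHom_rel R h

theorem mk_edge (e : E) : mk G R (FreeAlgebra.ι R (LGen.edge e)) = G.Se R e := rfl
theorem mk_ghost (e : E) : mk G R (FreeAlgebra.ι R (LGen.ghost e)) = G.St R e := rfl
theorem mk_proj (A : G.G0) : mk G R (FreeAlgebra.ι R (LGen.proj A)) = G.Pg R A := rfl

theorem Pg_empty : G.Pg R G.emptyG0 = 0 := by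
  simpa [mk_proj] using mk_rel G R LeavittRel.p_empty
theorem Pg_mul (A B : G.G0) : G.Pg R A * G.Pg R B = G.Pg R (G.interG0 A B) := by
  simpa [mk_proj] using mk_rel G R (LeavittRel.p_mul A B)
theorem Pg_union (A B : G.G0) :
    G.Pg R (G.unionG0 A B) = G.Pg R A + G.Pg R B - G.Pg R (G.interG0 A B) := by
  simpa [mk_proj] using mk_rel G R (LeavittRel.p_union A B)
theorem Ps_Se (e : E) : G.Pg R (G.vtx (G.s e)) * G.Se R e = G.Se R e := by
  simpa [mk_proj, mk_edge] using mk_rel G R (LeavittRel.src_edge e)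
theorem Se_Pr (e : E) : G.Se R e * G.Pg R (G.rng e) = G.Se R e := by
  simpa [mk_proj, mk_edge] using mk_rel G R (LeavittRel.edge_rng e)
theorem Pr_St (e : E) : G.Pg R (G.rng e) * G.St R e = G.St R e := by
  simpa [mk_proj, mk_ghost] using mk_rel G R (LeavittRel.rng_ghost e)
theorem St_Ps (e : E) : G.St R e * G.Pg R (G.vtx (G.s e)) = G.St R e := by
  simpa [mk_proj, mk_ghost] using mk_rel G R (LeavittRel.ghost_src e)
theorem St_Se_ne {e f : E} (h : e ≠ f) : G.St R e * G.Se R f = 0 := by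
  simpa [mk_edge, mk_ghost] using mk_rel G R (LeavittRel.ghost_edge_ne h)
theorem St_Se (e : E) : G.St R e * G.Se R e = G.Pg R (G.rng e) := by
  simpa [mk_edge, mk_ghost, mk_proj] using mk_rel G R (LeavittRel.ghost_edge e)
theorem Pg_ck (v : V) (hfin : {e : E | G.s e = v}.Finite) (hne : {e : E | G.s e = v}.Nonempty) :
    G.Pg R (G.vtx v) = ∑ e ∈ hfin.toFinset, G.Se R e * G.St R e := by
  have := mk_rel G R (LeavittRel.ck v hfin hne)
  simpa only [map_sum, map_mul, mk_edge, mk_ghost, mk_proj] using this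

theorem Pg_comm (A B : G.G0) : G.Pg R A * G.Pg R B = G.Pg R B * G.Pg R A := by
  rw [Pg_mul, Pg_mul]
  congr 1
  exact Subtype.ext (Set.inter_comm _ _)

theorem Pg_mul_of_subset {A B : G.G0} (h : A.1 ⊆ B.1) : G.Pg R A * G.Pg R B = G.Pg R A := by
  rw [Pg_mul]
  congr 1
  exact Subtype.ext (Set.inter_eq_left.2 h)

theorem Pg_vtx_mul_of_notMem {A : G.G0} {v : V} (h : v ∉ A.1) :
    G.Pg R A * G.Pg R (G.vtx v) = 0 := by
  rw [Pg_mul, ← Pg_empty]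
  congr 1
  apply Subtype.ext
  ext x
  simp only [interG0, vtx, emptyG0, Set.mem_inter_iff, Set.mem_singleton_iff,
    Set.mem_empty_iff_false, iff_false]
  rintro ⟨h1, rfl⟩
  exact h h1

theorem Pg_Se (A : G.G0) (e : E) :
    G.Pg R A * G.Se R e = if G.s e ∈ A.1 then G.Se R e else 0 := by
  split_ifs with h
  · conv_lhs => rw [← Ps_Se, ← mul_assoc, Pg_comm]
    rw [Pg_mul_of_subset, Ps_Se]
    simpa [vtx] using h
  · rw [← Ps_Se, ← mul_assoc, Pg_vtx_mul_of_notMem G R h, zero_mul]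

theorem St_Pg (A : G.G0) (e : E) :
    G.St R e * G.Pg R A = if G.s e ∈ A.1 then G.St R e else 0 := by
  split_ifs with h
  · conv_lhs => rw [← St_Ps, mul_assoc]
    rw [Pg_mul_of_subset, St_Ps]
    simpa [vtx] using h
  · rw [← St_Ps, mul_assoc, Pg_comm, Pg_vtx_mul_of_notMem G R h, mul_zero]

/-- The span of `1` and the projections `p_A`. -/
noncomputable def Q : Submodule R (LeavittAlgebra R G) :=
  Submodule.span R (insert 1 (Set.range (G.Pg R)))

theorem one_mem_Q : (1 : LeavittAlgebra R G) ∈ Q G R :=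
  Submodule.subset_span (Set.mem_insert _ _)

theorem Pg_mem_Q (A : G.G0) : G.Pg R A ∈ Q G R :=
  Submodule.subset_span (Set.mem_insert_of_mem _ ⟨A, rfl⟩)

theorem Q_induction {p : LeavittAlgebra R G → Prop} (h1 : p 1) (hP : ∀ A, p (G.Pg R A))
    (h0 : p 0) (hadd : ∀ a b, p a → p b → p (a + b)) (hsmul : ∀ (c : R) a, p a → p (c • a))
    {q : LeavittAlgebra R G} (hq : q ∈ Q G R) : p q := by
  refine Submodule.span_induction (p := fun q _ => p q) ?_ h0 (fun a b _ _ => hadd a b)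
    (fun c a _ => hsmul c a) hq
  rintro x (rfl | ⟨A, rfl⟩)
  · exact h1
  · exact hP A

theorem Q_Pg {q : LeavittAlgebra R G} (hq : q ∈ Q G R) (A : G.G0) : q * G.Pg R A ∈ Q G R := by
  refine Q_induction G R (p := fun q => q * G.Pg R A ∈ Q G R) ?_ ?_ ?_ ?_ ?_ hq
  · rw [one_mul]; exact Pg_mem_Q G R A
  · intro B; rw [Pg_mul]; exact Pg_mem_Q G R _
  · rw [zero_mul]; exact zero_mem _
  · intro a b ha hb; rw [add_mul]; exact add_mem ha hb
  · intro c a ha; rw [smul_mul_assoc]; exact Submodule.smul_mem _ _ ha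

theorem Pg_Q {q : LeavittAlgebra R G} (hq : q ∈ Q G R) (A : G.G0) : G.Pg R A * q ∈ Q G R := by
  refine Q_induction G R (p := fun q => G.Pg R A * q ∈ Q G R) ?_ ?_ ?_ ?_ ?_ hq
  · rw [mul_one]; exact Pg_mem_Q G R A
  · intro B; rw [Pg_mul]; exact Pg_mem_Q G R _
  · rw [mul_zero]; exact zero_mem _
  · intro a b ha hb; rw [mul_add]; exact add_mem ha hb
  · intro c a ha; rw [mul_smul_comm]; exact Submodule.smul_mem _ _ ha

theorem Q_Se {q : LeavittAlgebra R G} (hq : q ∈ Q G R) (e : E) :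
    ∃ c : R, q * G.Se R e = c • G.Se R e := by
  refine Q_induction G R (p := fun q => ∃ c : R, q * G.Se R e = c • G.Se R e) ?_ ?_ ?_ ?_ ?_ hq
  · exact ⟨1, by simp⟩
  · intro A
    rw [Pg_Se]
    split_ifs
    · exact ⟨1, by simp⟩
    · exact ⟨0, by simp⟩
  · exact ⟨0, by simp⟩
  · rintro a b ⟨c, hc⟩ ⟨d, hd⟩
    exact ⟨c + d, by rw [add_mul, hc, hd, add_smul]⟩
  · rintro c a ⟨d, hd⟩
    exact ⟨c * d, by rw [smul_mul_assoc, hd, mul_smul]⟩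

/-- Spans of `s_α q` with `|α| ≤ k`. -/
noncomputable def N : ℕ → Submodule R (LeavittAlgebra R G)
  | 0 => Q G R
  | k + 1 => Q G R ⊔ ⨆ e, (N k).map (LinearMap.mulLeft R (G.Se R e))

theorem N_decomp {k : ℕ} {w : LeavittAlgebra R G} (hw : w ∈ N G R (k + 1)) :
    ∃ q ∈ Q G R, ∃ (F : Finset E) (m : E → LeavittAlgebra R G), (∀ e, m e ∈ N G R k) ∧
      w = q + ∑ e ∈ F, G.Se R e * m e := by
  obtain ⟨q, hq, b, hb, rfl⟩ := Submodule.mem_sup.1 hw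
  obtain ⟨f, hf, rfl⟩ := (Submodule.mem_iSup_iff_exists_finsupp _ _).1 hb
  choose m hm hm' using hf
  refine ⟨q, hq, f.support, m, hm, ?_⟩
  congr 1
  exact Finset.sum_congr rfl fun e _ => (hm' e).symm

theorem Q_le_N (k : ℕ) : Q G R ≤ N G R k := by
  cases k with
  | zero => exact le_rfl
  | succ k => exact le_sup_left

theorem Se_N {k : ℕ} {w : LeavittAlgebra R G} (hw : w ∈ N G R k) (e : E) :
    G.Se R e * w ∈ N G R (k + 1) :=
  Submodule.mem_sup_right (Submodule.mem_iSup_of_mem e ⟨w, hw, rfl⟩)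

theorem N_mono : Monotone (N G R) := by
  apply monotone_nat_of_le_succ
  intro k
  induction k with
  | zero => exact Q_le_N G R 1
  | succ k ih =>
    exact sup_le_sup le_rfl (iSup_mono fun e => Submodule.map_mono ih)

theorem N_Pg {k : ℕ} {w : LeavittAlgebra R G} (hw : w ∈ N G R k) (A : G.G0) :
    w * G.Pg R A ∈ N G R k := by
  induction k generalizing w with
  | zero => exact Q_Pg G R hw A
  | succ k ih =>
    obtain ⟨q, hq, F, m, hm, rfl⟩ := N_decomp G R hw
    rw [add_mul, Finset.sum_mul]
    refine add_mem (Q_le_N G R _ (Q_Pg G R hq A)) (sum_mem fun e _ => ?_)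
    rw [mul_assoc]
    exact Se_N G R (ih (hm e)) e

theorem Pg_N {k : ℕ} {w : LeavittAlgebra R G} (hw : w ∈ N G R k) (A : G.G0) :
    G.Pg R A * w ∈ N G R k := by
  cases k with
  | zero => exact Pg_Q G R hw A
  | succ k =>
    obtain ⟨q, hq, F, m, hm, rfl⟩ := N_decomp G R hw
    rw [mul_add, Finset.mul_sum]
    refine add_mem (Q_le_N G R _ (Pg_Q G R hq A)) (sum_mem fun e _ => ?_)
    rw [← mul_assoc, Pg_Se]
    split_ifs
    · exact Se_N G R (hm e) e
    · rw [zero_mul]; exact zero_mem _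

theorem N_Se {k : ℕ} {w : LeavittAlgebra R G} (hw : w ∈ N G R k) (e : E) :
    w * G.Se R e ∈ N G R (k + 1) := by
  have key : ∀ q ∈ Q G R, q * G.Se R e ∈ N G R 1 := by
    intro q hq
    obtain ⟨c, hc⟩ := Q_Se G R hq e
    rw [hc]
    apply Submodule.smul_mem
    have := Se_N G R (k := 0) (one_mem_Q G R) e
    rwa [mul_one] at this
  induction k generalizing w with
  | zero => exact key w hw
  | succ k ih =>
    obtain ⟨q, hq, F, m, hm, rfl⟩ := N_decomp G R hw
    rw [add_mul, Finset.sum_mul]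
    refine add_mem (N_mono G R (by omega) (key q hq)) (sum_mem fun f _ => ?_)
    rw [mul_assoc]
    exact Se_N G R (ih (hm f)) f

/-- The span of all `s_α q`. -/
noncomputable def W : Submodule R (LeavittAlgebra R G) := ⨆ k, N G R k

theorem mem_W {w : LeavittAlgebra R G} : w ∈ W G R ↔ ∃ k, w ∈ N G R k :=
  Submodule.mem_iSup_of_directed _ (N_mono G R).directed_le

theorem W_Pg {w : LeavittAlgebra R G} (hw : w ∈ W G R) (A : G.G0) : w * G.Pg R A ∈ W G R := by
  obtain ⟨k, hk⟩ := (mem_W G R).1 hw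
  exact (mem_W G R).2 ⟨k, N_Pg G R hk A⟩

theorem W_Se {w : LeavittAlgebra R G} (hw : w ∈ W G R) (e : E) : w * G.Se R e ∈ W G R := by
  obtain ⟨k, hk⟩ := (mem_W G R).1 hw
  exact (mem_W G R).2 ⟨k + 1, N_Se G R hk e⟩

/-- Spans of `s_α q s_β*` with `|β| ≤ n`. -/
noncomputable def M : ℕ → Submodule R (LeavittAlgebra R G)
  | 0 => W G R
  | n + 1 => W G R ⊔ ⨆ e, (M n).map (LinearMap.mulRight R (G.St R e))

theorem M_decomp {n : ℕ} {a : LeavittAlgebra R G} (ha : a ∈ M G R (n + 1)) :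
    ∃ w ∈ W G R, ∃ (F : Finset E) (m : E → LeavittAlgebra R G), (∀ e, m e ∈ M G R n) ∧
      a = w + ∑ e ∈ F, m e * G.St R e := by
  obtain ⟨q, hq, b, hb, rfl⟩ := Submodule.mem_sup.1 ha
  obtain ⟨f, hf, rfl⟩ := (Submodule.mem_iSup_iff_exists_finsupp _ _).1 hb
  choose m hm hm' using hf
  refine ⟨q, hq, f.support, m, hm, ?_⟩
  congr 1
  exact Finset.sum_congr rfl fun e _ => (hm' e).symm

theorem W_le_M (n : ℕ) : W G R ≤ M G R n := by
  cases n with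
  | zero => exact le_rfl
  | succ n => exact le_sup_left

theorem M_St {n : ℕ} {a : LeavittAlgebra R G} (ha : a ∈ M G R n) (e : E) :
    a * G.St R e ∈ M G R (n + 1) :=
  Submodule.mem_sup_right (Submodule.mem_iSup_of_mem e ⟨a, ha, rfl⟩)

theorem M_mono : Monotone (M G R) := by
  apply monotone_nat_of_le_succ
  intro k
  induction k with
  | zero => exact W_le_M G R 1
  | succ k ih =>
    exact sup_le_sup le_rfl (iSup_mono fun e => Submodule.map_mono ih)

theorem M_Pg {n : ℕ} {a : LeavittAlgebra R G} (ha : a ∈ M G R n) (A : G.G0) :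
    a * G.Pg R A ∈ M G R n := by
  cases n with
  | zero => exact W_Pg G R ha A
  | succ n =>
    obtain ⟨q, hq, F, m, hm, rfl⟩ := M_decomp G R ha
    rw [add_mul, Finset.sum_mul]
    refine add_mem (W_le_M G R _ (W_Pg G R hq A)) (sum_mem fun e _ => ?_)
    rw [mul_assoc, St_Pg]
    split_ifs
    · exact M_St G R (hm e) e
    · rw [mul_zero]; exact zero_mem _

theorem M_succ_Se {n : ℕ} {a : LeavittAlgebra R G} (ha : a ∈ M G R (n + 1)) (e : E) :
    a * G.Se R e ∈ M G R n := by
  obtain ⟨q, hq, F, m, hm, rfl⟩ := M_decomp G R ha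
  rw [add_mul, Finset.sum_mul]
  refine add_mem (W_le_M G R _ (W_Se G R hq e)) (sum_mem fun f _ => ?_)
  rw [mul_assoc]
  by_cases h : f = e
  · subst h
    rw [St_Se]
    exact M_Pg G R (hm f) _
  · rw [St_Se_ne G R h, mul_zero]
    exact zero_mem _

theorem exists_mem_M (a : LeavittAlgebra R G) : ∃ n, a ∈ M G R n := by
  have key : ∀ z : FreeAlgebra R (LGen G), ∀ a, (∃ n, a ∈ M G R n) →
      ∃ n, a * mk G R z ∈ M G R n := by
    intro z
    induction z using FreeAlgebra.induction with
    | grade0 c =>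
      rintro a ⟨n, hn⟩
      refine ⟨n, ?_⟩
      rw [AlgHom.commutes, ← Algebra.commutes, ← Algebra.smul_def]
      exact Submodule.smul_mem _ _ hn
    | grade1 g =>
      rintro a ⟨n, hn⟩
      cases g with
      | edge e => exact ⟨n, M_succ_Se G R (M_mono G R (Nat.le_succ n) hn) e⟩
      | ghost e => exact ⟨n + 1, M_St G R hn e⟩
      | proj A => exact ⟨n, M_Pg G R hn A⟩
    | mul x y hx hy =>
      intro a ha
      rw [map_mul, ← mul_assoc]
      exact hy _ (hx _ ha)
    | add x y hx hy =>
      intro a ha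
      obtain ⟨n, hn⟩ := hx a ha
      obtain ⟨m, hm⟩ := hy a ha
      refine ⟨max n m, ?_⟩
      rw [map_add, mul_add]
      exact add_mem (M_mono G R (le_max_left _ _) hn) (M_mono G R (le_max_right _ _) hm)
  obtain ⟨z, rfl⟩ := mk_surj G R a
  have := key z 1 ⟨0, (mem_W G R).2 ⟨0, one_mem_Q G R⟩⟩
  rwa [one_mul] at this

/-- The combinatorial core: linear relations between indicator functions hold for projections. -/
theorem comb (c : G.G0 → R) (S : Finset G.G0) : ∀ (B C : G.G0) (k : R),
    (∀ v ∈ B.1, v ∉ C.1 → (∑ A ∈ S, if v ∈ A.1 then c A else 0) = k) →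
    G.Pg R B * (1 - G.Pg R C) * (∑ A ∈ S, c A • G.Pg R A - k • 1) = 0 := by
  induction S using Finset.induction_on with
  | empty =>
    intro B C k h
    by_cases hBC : B.1 ⊆ C.1
    · have h0 : G.Pg R B * (1 - G.Pg R C) = 0 := by
        rw [mul_sub, Pg_mul_of_subset G R hBC, mul_one, sub_self]
      rw [h0, zero_mul]
    · obtain ⟨v, hB, hC⟩ := Set.not_subset.1 hBC
      have := h v hB hC
      rw [Finset.sum_empty] at this
      simp [← this]
  | insert A S hA ih =>
    intro B C k h
    have e1 := ih (G.interG0 B A) C (k - c A) (by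
      rintro v ⟨hB, hA'⟩ hC
      have := h v hB hC
      rw [Finset.sum_insert hA, if_pos hA'] at this
      rw [← this]; ring)
    have e2 := ih B (G.unionG0 C A) k (by
      intro v hB hC
      have := h v hB (fun h' => hC (Or.inl h'))
      rw [Finset.sum_insert hA, if_neg (fun h' => hC (Or.inr h')), zero_add] at this
      exact this)
    rw [Finset.sum_insert hA]
    rw [← Pg_mul] at e1
    rw [Pg_union, ← Pg_mul] at e2
    have hAA : G.Pg R A * G.Pg R A = G.Pg R A := Pg_mul_of_subset G R (le_refl _)
    have hCA := Pg_comm G R C A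
    set pA := G.Pg R A
    set pB := G.Pg R B
    set pC := G.Pg R C
    set T := ∑ A ∈ S, c A • G.Pg R A
    rw [← add_zero (0 : LeavittAlgebra R G)]
    nth_rewrite 1 [← e1]
    rw [← e2]
    have h3 : pB * pA * (1 - pC) = pB * (1 - pC) * pA := by
      rw [mul_assoc, mul_assoc, mul_sub, sub_mul, mul_one, one_mul, hCA]
    have h4 : pB * (1 - (pC + pA - pC * pA)) = pB * (1 - pC) * (1 - pA) := by
      rw [mul_assoc]; congr 1; noncomm_ring
    rw [h3, h4, mul_assoc (pB * (1 - pC)), mul_assoc (pB * (1 - pC)), ← mul_add]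
    congr 1
    rw [sub_smul]
    simp only [mul_sub, sub_mul, one_mul, mul_smul_comm, mul_one, smul_sub]
    abel

theorem exists_bound (S : Finset G.G0) : ∃ B : G.G0, ∀ A ∈ S, A.1 ⊆ B.1 := by
  induction S using Finset.induction_on with
  | empty => exact ⟨G.emptyG0, by simp⟩
  | insert A S hA ih =>
    obtain ⟨B, hB⟩ := ih
    refine ⟨G.unionG0 A B, fun A' hA' => ?_⟩
    rcases Finset.mem_insert.1 hA' with rfl | h
    · exact Set.subset_union_left
    · exact (hB A' h).trans Set.subset_union_right

theorem comb' (c : G.G0 → R) (S : Finset G.G0)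
    (h : ∀ v, (∑ A ∈ S, if v ∈ A.1 then c A else 0) = 0) :
    ∑ A ∈ S, c A • G.Pg R A = 0 := by
  obtain ⟨B, hB⟩ := exists_bound G S
  have := comb G R c S B G.emptyG0 0 (fun v _ _ => h v)
  rw [Pg_empty, sub_zero, mul_one, zero_smul, sub_zero, Finset.mul_sum] at this
  rw [← this]
  refine Finset.sum_congr rfl fun A hA => ?_
  rw [mul_smul_comm, Pg_comm, Pg_mul_of_subset G R (hB A hA)]

theorem exists_finite_G0 (U : Finset V) (q : LeavittAlgebra R G)
    (h : ∀ v ∈ U, G.Pg R (G.vtx v) * q = 0) :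
    ∃ A : G.G0, A.1 = ↑U ∧ G.Pg R A * q = 0 := by
  induction U using Finset.induction_on with
  | empty => exact ⟨G.emptyG0, by simp [emptyG0], by rw [Pg_empty, zero_mul]⟩
  | insert v U hv ih =>
    obtain ⟨A, hA, hA'⟩ := ih fun v hv => h v (Finset.mem_insert_of_mem hv)
    refine ⟨G.unionG0 (G.vtx v) A, ?_, ?_⟩
    · simp only [unionG0, vtx, hA, Finset.coe_insert]
      rfl
    · rw [Pg_union, ← Pg_mul, sub_mul, add_mul, mul_assoc, hA', h v (Finset.mem_insert_self _ _)]
      simp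

end Alg

section Inj

variable {V : Type u} {E : Type v} {G : Ultragraph V E} {X : Type*} (R : Type w) [CommRing R]

/-- Extra structure on a branching system guaranteeing faithfulness. -/
structure Good (B : BranchingSystem G X) where
  vert : X → Option V
  deg : X → ℤ
  mem_D : ∀ A x, x ∈ B.D A ↔ ∃ v ∈ A.1, vert x = some v
  deg_fe : ∀ e (y : B.D (G.rng e)), deg (B.fe e y) = deg y + 1
  surj : ∀ o, ∃ x, vert x = o

variable {B : BranchingSystem G X} (H : Good B)

/-- Functions supported in degrees at least `d`. -/
def Fil (d : ℤ) : Submodule R (X → R) where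
  carrier := {φ | ∀ y, H.deg y < d → φ y = 0}
  zero_mem' := fun _ _ => rfl
  add_mem' := fun {φ ψ} h1 h2 y hy => by simp [h1 y hy, h2 y hy]
  smul_mem' := fun c φ h y hy => by simp [h y hy]

theorem Fil_Se {d : ℤ} {φ : X → R} (hφ : φ ∈ Fil R H d) (e : E) :
    rep R B (G.Se R e) φ ∈ Fil R H (d + 1) := by
  intro y hy
  rw [rep_Se, opS_apply]
  split_ifs with h
  · apply hφ
    have := H.deg_fe e ((B.fe e).symm ⟨y, h⟩)
    rw [Equiv.apply_symm_apply] at this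
    simp only at this
    omega
  · rfl

theorem Fil_Q {d : ℤ} {φ : X → R} (hφ : φ ∈ Fil R H d) {q : LeavittAlgebra R G}
    (hq : q ∈ Q G R) : rep R B q φ ∈ Fil R H d := by
  refine Q_induction G R (p := fun q => rep R B q φ ∈ Fil R H d) ?_ ?_ ?_ ?_ ?_ hq
  · simpa using hφ
  · intro A y hy
    rw [rep_Pg, opP_apply, hφ y hy, ite_self]
  · simp
  · intro a b ha hb
    rw [map_add]; exact add_mem ha hb
  · intro c a ha
    rw [map_smul]; exact Submodule.smul_mem _ _ ha

theorem Fil_mono {d d' : ℤ} (h : d ≤ d') : Fil R H d' ≤ Fil R H d :=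
  fun _ hφ y hy => hφ y (lt_of_lt_of_le hy h)

theorem Fil_N {d : ℤ} {φ : X → R} (hφ : φ ∈ Fil R H d) {k : ℕ} {w : LeavittAlgebra R G}
    (hw : w ∈ N G R k) : rep R B w φ ∈ Fil R H d := by
  induction k generalizing w with
  | zero => exact Fil_Q R H hφ hw
  | succ k ih =>
    obtain ⟨q, hq, F, m, hm, rfl⟩ := N_decomp G R hw
    rw [map_add, map_sum, LinearMap.add_apply, LinearMap.sum_apply]
    refine add_mem (Fil_Q R H hφ hq) (sum_mem fun e _ => ?_)
    rw [map_mul, Module.End.mul_apply]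
    exact Fil_mono R H (by omega) (Fil_Se R H (ih (hm e)) e)

theorem rep_Pg_single (A : G.G0) (x : X) :
    rep R B (G.Pg R A) (Pi.single x 1) = if x ∈ B.D A then Pi.single x 1 else 0 := by
  rw [rep_Pg]
  funext y
  rw [opP_apply]
  by_cases hy : y = x
  · subst hy
    split_ifs <;> simp
  · split_ifs <;> simp [Pi.single_eq_of_ne hy]

theorem rep_Q_single {q : LeavittAlgebra R G} (hq : q ∈ Q G R) (x : X) :
    ∃ c : R, rep R B q (Pi.single x 1) = c • Pi.single x 1 := by
  refine Q_induction G R (p := fun q => ∃ c : R, rep R B q (Pi.single x 1) = c • Pi.single x 1)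
    ?_ ?_ ?_ ?_ ?_ hq
  · exact ⟨1, by simp⟩
  · intro A
    rw [rep_Pg_single]
    split_ifs
    · exact ⟨1, by simp⟩
    · exact ⟨0, by simp⟩
  · exact ⟨0, by simp⟩
  · rintro a b ⟨c, hc⟩ ⟨d, hd⟩
    exact ⟨c + d, by rw [map_add, LinearMap.add_apply, hc, hd, add_smul]⟩
  · rintro c a ⟨d, hd⟩
    exact ⟨c * d, by rw [map_smul, LinearMap.smul_apply, hd, mul_smul]⟩

theorem Q_inj {q : LeavittAlgebra R G} (hq : q ∈ Q G R) (x : Option V → X)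
    (hx : ∀ o, H.vert (x o) = o) (h : ∀ o, rep R B q (Pi.single (x o) 1) = 0) : q = 0 := by
  obtain ⟨l, z, hz, rfl⟩ := Submodule.mem_span_insert.1 hq
  obtain ⟨c, rfl⟩ := (Finsupp.mem_span_range_iff_exists_finsupp).1 hz
  have key : ∀ o, l + ∑ A ∈ c.support, (if ∃ v ∈ A.1, o = some v then c A else 0) = 0 := by
    intro o
    have := congrFun (h o) (x o)
    rw [map_add, map_smul, map_one, Finsupp.sum, map_sum, LinearMap.add_apply,
      LinearMap.sum_apply, Pi.add_apply, Finset.sum_apply] at this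
    simp only [map_smul, LinearMap.smul_apply, rep_Pg_single, H.mem_D, hx] at this
    rw [Pi.zero_apply] at this
    refine Eq.trans ?_ this
    congr 1
    · simp
    · refine Finset.sum_congr rfl fun A _ => ?_
      by_cases hA : ∃ v ∈ A.1, o = some v
      · rw [if_pos hA, if_pos hA]; simp
      · rw [if_neg hA, if_neg hA]; simp
  have hl : l = 0 := by simpa using key none
  subst hl
  rw [zero_smul, zero_add]
  apply comb' G R c c.support
  intro v
  have := key (some v)
  simpa using this

theorem N_inj (x : Option V → X) (hx : ∀ o, H.vert (x o) = o) {k : ℕ} {w : LeavittAlgebra R G}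
    (hw : w ∈ N G R k) (h : ∀ o, rep R B w (Pi.single (x o) 1) = 0) : w = 0 := by
  induction k generalizing w with
  | zero => exact Q_inj R H hw x hx h
  | succ k ih =>
    obtain ⟨q, hq, F, m, hm, rfl⟩ := N_decomp G R hw
    set b := ∑ e ∈ F, G.Se R e * m e with hb
    have hq0 : ∀ o, rep R B q (Pi.single (x o) 1) = 0 := by
      intro o
      have h1 : (Pi.single (x o) 1 : X → R) ∈ Fil R H (H.deg (x o)) := by
        intro y hy
        apply Pi.single_eq_of_ne
        rintro rfl
        exact lt_irrefl _ hy
      have h2 : rep R B b (Pi.single (x o) 1) ∈ Fil R H (H.deg (x o) + 1) := by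
        rw [hb, map_sum, LinearMap.sum_apply]
        refine sum_mem fun e _ => ?_
        rw [map_mul, Module.End.mul_apply]
        exact Fil_Se R H (Fil_N R H h1 (hm e)) e
      obtain ⟨c, hc⟩ := rep_Q_single R (B := B) hq (x o)
      have h3 := congrFun (h o) (x o)
      rw [map_add, LinearMap.add_apply, Pi.add_apply, h2 (x o) (by omega), hc] at h3
      have : c = 0 := by simpa using h3
      rw [hc, this, zero_smul]
    have hq' : q = 0 := Q_inj R H hq x hx hq0
    have hterm : ∀ e ∈ F, G.Se R e * m e = 0 := by
      intro e he
      have h1 : G.St R e * (q + b) = G.Pg R (G.rng e) * m e := by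
        rw [hq', zero_add, hb, Finset.mul_sum, Finset.sum_eq_single e]
        · rw [← mul_assoc, St_Se]
        · intro f _ hf
          rw [← mul_assoc, St_Se_ne G R hf.symm, zero_mul]
        · exact fun h => absurd he h
      have h2 : G.Pg R (G.rng e) * m e = 0 := by
        refine ih (Pg_N G R (hm e) _) fun o => ?_
        rw [← h1, map_mul, Module.End.mul_apply, h o, map_zero]
      rw [← Se_Pr, mul_assoc, h2, mul_zero]
    rw [hq', hb, Finset.sum_eq_zero hterm, add_zero]

theorem W_inj (x : Option V → X) (hx : ∀ o, H.vert (x o) = o) {w : LeavittAlgebra R G}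
    (hw : w ∈ W G R) (h : ∀ o, rep R B w (Pi.single (x o) 1) = 0) : w = 0 := by
  obtain ⟨k, hk⟩ := (mem_W G R).1 hw
  exact N_inj R H x hx hk h

theorem rep_SeSt_single {e : E} {x : X} (hx : x ∉ B.Re e) :
    rep R B (G.Se R e * G.St R e) (Pi.single x 1) = 0 := by
  rw [map_mul, rep_Se, rep_St]
  funext y
  rw [opST_apply]
  split_ifs with h
  · apply Pi.single_eq_of_ne
    rintro rfl
    exact hx h
  · rfl

theorem Re_nonempty (H : Good B) (e : E) : (B.Re e).Nonempty := by
  obtain ⟨v, hv⟩ := G.r_nonempty e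
  obtain ⟨x, hx⟩ := H.surj (some v)
  exact ⟨_, (B.fe e ⟨x, (H.mem_D _ _).2 ⟨v, hv, hx⟩⟩).2⟩

theorem WF_inj (H : Good B) {w : LeavittAlgebra R G} (hw : w ∈ W G R) (F : Finset E)
    (h : rep R B (w * (1 - ∑ e ∈ F, G.Se R e * G.St R e)) = 0) :
    w * (1 - ∑ e ∈ F, G.Se R e * G.St R e) = 0 := by
  set q := 1 - ∑ e ∈ F, G.Se R e * G.St R e with hqdef
  let U : Finset V := (F.image G.s).filter fun v => ∀ e, G.s e = v → e ∈ F
  have hU : ∀ v ∈ U, G.Pg R (G.vtx v) * q = 0 := by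
    intro v hv
    obtain ⟨hv1, hv2⟩ := Finset.mem_filter.1 hv
    obtain ⟨e0, he0, rfl⟩ := Finset.mem_image.1 hv1
    have hfin : {e : E | G.s e = G.s e0}.Finite :=
      F.finite_toSet.subset fun e he => hv2 e he
    rw [hqdef, mul_sub, mul_one, Finset.mul_sum]
    conv_lhs => enter [1]; rw [Pg_ck G R (G.s e0) hfin ⟨e0, rfl⟩]
    rw [sub_eq_zero]
    have hsub : hfin.toFinset ⊆ F := fun e he => hv2 e (by simpa using he)
    rw [← Finset.sum_subset hsub (f := fun e => G.Pg R (G.vtx (G.s e0)) * (G.Se R e * G.St R e))]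
    · refine Finset.sum_congr rfl fun e he => ?_
      have : G.s e = G.s e0 := by simpa using he
      rw [← this, ← mul_assoc, Ps_Se]
    · intro e _ he
      have : G.s e ≠ G.s e0 := by simpa using he
      rw [← mul_assoc, Pg_Se, if_neg, zero_mul]
      simpa [vtx] using this
  obtain ⟨A, hA, hAq⟩ := exists_finite_G0 G R U q hU
  have hw' : w * (1 - G.Pg R A) ∈ W G R := by
    rw [mul_sub, mul_one]
    exact sub_mem hw (W_Pg G R hw A)
  have hqq : (1 - G.Pg R A) * q = q := by rw [sub_mul, hAq, one_mul, sub_zero]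
  have hpts : ∀ o : Option V, ∃ x, H.vert x = o ∧
      ((∃ v ∈ U, o = some v) ∨ ∀ e ∈ F, x ∉ B.Re e) := by
    intro o
    have hRe : ∀ e x, x ∈ B.Re e → H.vert x = some (G.s e) := by
      intro e x hx
      obtain ⟨v, hv, hv'⟩ := (H.mem_D _ _).1 (B.Re_subset e hx)
      rw [hv']
      congr 1
    by_cases h1 : ∃ e, e ∉ F ∧ some (G.s e) = o
    · obtain ⟨e, he, rfl⟩ := h1
      obtain ⟨x, hx⟩ := Re_nonempty H e
      refine ⟨x, hRe e x hx, Or.inr fun f hf hxf => ?_⟩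
      have hne : e ≠ f := fun h => he (h ▸ hf)
      have : x ∈ B.Re e ∩ B.Re f := ⟨hx, hxf⟩
      rw [B.disj hne] at this
      exact this
    · push Not at h1
      obtain ⟨x, hx⟩ := H.surj o
      refine ⟨x, hx, ?_⟩
      by_cases h2 : ∃ e ∈ F, x ∈ B.Re e
      · obtain ⟨e, he, hxe⟩ := h2
        left
        have h3 := hRe e x hxe
        rw [hx] at h3
        refine ⟨G.s e, Finset.mem_filter.2 ⟨Finset.mem_image_of_mem _ he, fun f hf => ?_⟩, h3⟩
        by_contra hfF
        exact h1 f hfF (by rw [hf, h3])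
      · right
        push Not at h2
        exact h2
  choose x hx hx2 using hpts
  have hz : w * (1 - G.Pg R A) = 0 := by
    refine W_inj R H x hx hw' fun o => ?_
    rcases hx2 o with ⟨v, hv, ho⟩ | hF
    · have : x o ∈ B.D A := (H.mem_D _ _).2 ⟨v, by rw [hA]; exact hv, by rw [hx, ho]⟩
      rw [map_mul, Module.End.mul_apply, map_sub, map_one, LinearMap.sub_apply,
        rep_Pg_single, if_pos this]
      simp
    · have h1 : rep R B q (Pi.single (x o) 1) = Pi.single (x o) 1 := by
        rw [hqdef, map_sub, map_one, map_sum, LinearMap.sub_apply, LinearMap.sum_apply,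
          Finset.sum_eq_zero fun e he => rep_SeSt_single R (hF e he)]
        simp
      rw [← h1, ← Module.End.mul_apply, ← map_mul, mul_assoc, hqq, h, LinearMap.zero_apply]
  rw [← hqq, ← mul_assoc, hz, zero_mul]

theorem M_inj (H : Good B) {n : ℕ} {a : LeavittAlgebra R G} (ha : a ∈ M G R n) (h : rep R B a = 0) :
    a = 0 := by
  induction n generalizing a with
  | zero =>
    have := WF_inj R H ha ∅ (by simpa using h)
    simpa using this
  | succ n ih =>
    have hS : ∀ e, a * G.Se R e = 0 := fun e =>
      ih (M_succ_Se G R ha e) (by rw [map_mul, h, zero_mul])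
    obtain ⟨w, hw, F, m, hm, rfl⟩ := M_decomp G R ha
    have hterm : ∀ e ∈ F, m e * G.St R e = - (w * (G.Se R e * G.St R e)) := by
      intro e he
      have h1 : w * G.Se R e + m e * G.Pg R (G.rng e) = 0 := by
        rw [← hS e, add_mul, Finset.sum_mul, Finset.sum_eq_single e]
        · rw [mul_assoc (m e), St_Se]
        · intro f _ hf
          rw [mul_assoc, St_Se_ne G R hf, mul_zero]
        · exact fun h => absurd he h
      rw [← Pr_St, ← mul_assoc, eq_neg_of_add_eq_zero_right h1, Pr_St, neg_mul, mul_assoc]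
    have heq : w + ∑ e ∈ F, m e * G.St R e = w * (1 - ∑ e ∈ F, G.Se R e * G.St R e) := by
      rw [Finset.sum_congr rfl hterm, Finset.sum_neg_distrib, mul_sub, mul_one, Finset.mul_sum,
        sub_eq_add_neg]
    rw [heq] at h ⊢
    exact WF_inj R H hw F h

theorem rep_inj (H : Good B) : Function.Injective (rep R B) := by
  rw [injective_iff_map_eq_zero]
  intro a ha
  obtain ⟨n, hn⟩ := exists_mem_M G R a
  exact M_inj R H hn ha

end Inj

section Construct

variable {V : Type u} {E : Type v} (G : Ultragraph V E)

/-- A large index set. -/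
abbrev K (V : Type u) (E : Type v) : Type max u v := V ⊕ (E ⊕ ℕ)

theorem exists_equiv (v : V) (h : ∃ e, G.s e = v) :
    Nonempty (K V E ≃ Σ e : {e : E // G.s e = v}, (G.r e.1 × K V E)) := by
  obtain ⟨e, he⟩ := h
  obtain ⟨x, hx⟩ := G.r_nonempty e
  have hinf : Cardinal.aleph0 ≤ Cardinal.mk (K V E) := Cardinal.aleph0_le_mk _
  have hKK : Nonempty (K V E × K V E ≃ K V E) := by
    rw [← Cardinal.eq, Cardinal.mk_prod, Cardinal.lift_id]
    exact Cardinal.mul_eq_self hinf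
  obtain ⟨j⟩ := hKK
  let f : K V E → Σ e : {e : E // G.s e = v}, (G.r e.1 × K V E) :=
    fun k => ⟨⟨e, he⟩, ⟨x, hx⟩, k⟩
  let g : (Σ e : {e : E // G.s e = v}, (G.r e.1 × K V E)) → K V E :=
    fun p => j (Sum.inr (Sum.inl p.1.1), j (Sum.inl p.2.1.1, p.2.2))
  have hf : Function.Injective f := by
    intro a b hab
    simpa [f] using hab
  have hg : Function.Injective g := by
    rintro ⟨⟨e, he⟩, ⟨a, ha⟩, k⟩ ⟨⟨e', he'⟩, ⟨a', ha'⟩, k'⟩ h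
    simp only [g, j.injective.eq_iff, Prod.mk.injEq, Sum.inr.injEq, Sum.inl.injEq] at h
    obtain ⟨rfl, rfl, rfl⟩ := h
    rfl
  obtain ⟨F, hF⟩ := Function.Embedding.schroeder_bernstein hf hg
  exact ⟨Equiv.ofBijective F hF⟩

/-- The chosen splitting of the index set. -/
noncomputable def Φ (v : V) (h : ∃ e, G.s e = v) :
    K V E ≃ Σ e : {e : E // G.s e = v}, (G.r e.1 × K V E) := (exists_equiv G v h).some

/-- The underlying set of the branching system. -/
abbrev XX (V : Type u) (E : Type v) : Type max u v := Option (V × K V E × ℤ)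

/-- The underlying map of `f_e`. -/
noncomputable def fmap (e : E) (p : G.r e × K V E × ℤ) : XX V E :=
  some (G.s e, (Φ G (G.s e) ⟨e, rfl⟩).symm ⟨⟨e, rfl⟩, p.1, p.2.1⟩, p.2.2 + 1)

theorem fmap_inj (e : E) : Function.Injective (fmap G e) := by
  rintro ⟨a, k, n⟩ ⟨a', k', n'⟩ h
  simpa [fmap, and_assoc] using h

theorem fmap_disj {e f : E} {p q} (h : fmap G e p = fmap G f q) : e = f := by
  simp only [fmap, Option.some.injEq, Prod.mk.injEq] at h
  obtain ⟨h1, h2, -⟩ := h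
  have key : ∀ (v w : V) (hv : ∃ e, G.s e = v) (hw : ∃ e, G.s e = w) a b, v = w →
      (Φ G v hv).symm a = (Φ G w hw).symm b → a.1.1 = b.1.1 := by
    rintro v _ hv hw a b rfl hab
    rw [(Φ G v hv).symm.injective hab]
  exact key _ _ _ _ _ _ h1 h2

/-- The domains. -/
def DD (A : G.G0) : Set (XX V E) := {x | ∃ v ∈ A.1, x.map Prod.fst = some v}

/-- `D_{r(e)}` as a product. -/
noncomputable def dEquiv (e : E) : ↥(DD G (G.rng e)) ≃ (G.r e × K V E × ℤ) := by
  refine (Equiv.ofBijective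
    (fun p : G.r e × K V E × ℤ =>
      (⟨some (p.1.1, p.2), p.1.1, p.1.2, rfl⟩ : ↥(DD G (G.rng e)))) ⟨?_, ?_⟩).symm
  · rintro ⟨⟨a, ha⟩, k⟩ ⟨⟨a', ha'⟩, k'⟩ h
    have h' := congrArg Subtype.val h
    simpa using h'
  · rintro ⟨_ | ⟨a, k⟩, v, hv, hx⟩
    · simp at hx
    · simp only [Option.map_some, Option.some.injEq] at hx
      subst hx
      exact ⟨⟨⟨a, hv⟩, k⟩, rfl⟩

theorem dEquiv_symm (e : E) (p : G.r e × K V E × ℤ) :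
    ((dEquiv G e).symm p : XX V E) = some (p.1.1, p.2) := rfl

/-- The branching system. -/
noncomputable def BB : BranchingSystem G (XX V E) where
  Re e := Set.range (fmap G e)
  D := DD G
  disj := by
    intro e f hne
    ext x
    simp only [Set.mem_inter_iff, Set.mem_range, Set.mem_empty_iff_false, iff_false]
    rintro ⟨⟨p, rfl⟩, ⟨q, hq⟩⟩
    exact hne (fmap_disj G hq).symm
  D_empty := by
    ext x
    simp [DD, emptyG0]
  D_inter := by
    intro A B
    ext x
    simp only [DD, interG0, Set.mem_inter_iff, Set.mem_ofPred_eq]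
    constructor
    · rintro ⟨⟨v, hv, h⟩, ⟨v', hv', h'⟩⟩
      rw [h] at h'
      obtain rfl := Option.some.inj h'
      exact ⟨v, ⟨hv, hv'⟩, h⟩
    · rintro ⟨v, ⟨hv, hv'⟩, h⟩
      exact ⟨⟨v, hv, h⟩, ⟨v, hv', h⟩⟩
  D_union := by
    intro A B
    ext x
    simp only [DD, unionG0, Set.mem_union, Set.mem_ofPred_eq]
    constructor
    · rintro (⟨v, hv, h⟩ | ⟨v, hv, h⟩)
      · exact ⟨v, Or.inl hv, h⟩
      · exact ⟨v, Or.inr hv, h⟩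
    · rintro ⟨v, hv | hv, h⟩
      · exact Or.inl ⟨v, hv, h⟩
      · exact Or.inr ⟨v, hv, h⟩
  Re_subset := by
    rintro e _ ⟨p, rfl⟩
    exact ⟨G.s e, rfl, rfl⟩
  D_vtx := by
    rintro v - ⟨e0, he0⟩
    ext x
    simp only [Set.mem_iUnion]
    constructor
    · rintro ⟨v', hv', hx⟩
      obtain rfl : v' = v := hv'
      rcases x with _ | ⟨a, k, n⟩
      · simp at hx
      · simp only [Option.map_some, Option.some.injEq] at hx
        subst hx
        obtain ⟨⟨⟨e, he⟩, p, k'⟩, rfl⟩ := (Φ G a ⟨e0, he0⟩).symm.surjective k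
        subst he
        exact ⟨e, rfl, ⟨p, k', n - 1⟩, by simp [fmap]⟩
    · rintro ⟨e, he, p, rfl⟩
      exact ⟨v, rfl, congrArg some he⟩
  fe e := (dEquiv G e).trans (Equiv.ofInjective _ (fmap_inj G e))

/-- The branching system is good. -/
noncomputable def goodBB : Good (BB G) where
  vert x := x.map Prod.fst
  deg x := x.elim 0 fun p => p.2.2
  mem_D A x := Iff.rfl
  deg_fe e y := by
    obtain ⟨p, rfl⟩ := (dEquiv G e).symm.surjective y
    have : ((BB G).fe e ((dEquiv G e).symm p) : XX V E) = fmap G e p := by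
      change ((Equiv.ofInjective _ (fmap_inj G e) (dEquiv G e ((dEquiv G e).symm p))) : XX V E) = _
      rw [Equiv.apply_symm_apply, Equiv.ofInjective_apply]
    rw [this, dEquiv_symm]
    rfl
  surj o := by
    cases o with
    | none => exact ⟨none, rfl⟩
    | some v => exact ⟨some (v, Sum.inr (Sum.inr 0), 0), rfl⟩

end Construct

end Faithful
end Ultragraph

open Ultragraph in
/-- For `𝒢` with countable (or finite) `s⁻¹(v)` and `r(e)` there is a branching system
whose induced representation is faithful. -/
theorem exists_branchingSystem_injective_representation {V : Type u} {E : Type v}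
    (G : Ultragraph V E)
    (h1 : ∀ v : V, {e : E | G.s e = v}.Countable)
    (h2 : ∀ e : E, (G.r e).Countable)
    (R : Type w) [CommRing R] [Nontrivial R] :
    ∃ (X : Type (max u v)) (B : G.BranchingSystem X)
      (π : LeavittAlgebra R G →ₐ[R] Module.End R (X → R)),
      IsInducedRep G R B π ∧ Function.Injective ⇑π := by
  exact ⟨Faithful.XX V E, Faithful.BB G, Faithful.rep R (Faithful.BB G),
    Faithful.rep_induced R _, Faithful.rep_inj R (Faithful.goodBB G)⟩
end

section
/- Let 𝒢 be an ultragraph, R a unital commutative ring, N an R-module, and φ : L_R(𝒢) → Hom_R(N) a permutative representation with associated bases B, B_v, B_{r(e)}, B_e. Suppose that φ(p_A)(h) = 0 for every A ∈ 𝒢⁰ and every h ∈ B∖B_A, and that φ(s_e*)(h) = 0 for every e ∈ 𝒢¹ and every h ∈ B∖B_e. Then there exists a 𝒢-algebraic branching system on a set X such that the representation π : L_R(𝒢) → Hom_R(M) induced on the R-module M of finitely supported functions from X to R is equivalent to φ. -/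
universe u v w

universe x

namespace Ultragraph

section Rels

variable {V : Type u} {E : Type v} (G : Ultragraph V E) (R : Type w) [CommRing R]

theorem Pg_empty : G.Pg R G.emptyG0 = 0 :=
  (RingQuot.mkAlgHom_rel R (LeavittRel.p_empty (R := R) (G := G))).trans (map_zero _)

theorem Pg_mul (A B : G.G0) : G.Pg R A * G.Pg R B = G.Pg R (G.interG0 A B) :=
  (map_mul (RingQuot.mkAlgHom R (LeavittRel R G)) _ _).symm.trans
    (RingQuot.mkAlgHom_rel R (LeavittRel.p_mul (R := R) A B))

theorem Pg_union (A B : G.G0) :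
    G.Pg R (G.unionG0 A B) = G.Pg R A + G.Pg R B - G.Pg R (G.interG0 A B) := by
  refine (RingQuot.mkAlgHom_rel R (LeavittRel.p_union (R := R) A B)).trans ?_
  rw [map_sub, map_add]
  rfl

theorem Pg_src (e : E) : G.Pg R (G.vtx (G.s e)) * G.Se R e = G.Se R e :=
  (map_mul (RingQuot.mkAlgHom R (LeavittRel R G)) _ _).symm.trans
    (RingQuot.mkAlgHom_rel R (LeavittRel.src_edge (R := R) e))

theorem Se_rng (e : E) : G.Se R e * G.Pg R (G.rng e) = G.Se R e :=
  (map_mul (RingQuot.mkAlgHom R (LeavittRel R G)) _ _).symm.trans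
    (RingQuot.mkAlgHom_rel R (LeavittRel.edge_rng (R := R) e))

theorem St_Se_ne {e f : E} (h : e ≠ f) : G.St R e * G.Se R f = 0 :=
  (map_mul (RingQuot.mkAlgHom R (LeavittRel R G)) _ _).symm.trans
    ((RingQuot.mkAlgHom_rel R (LeavittRel.ghost_edge_ne (R := R) h)).trans (map_zero _))

theorem St_Se (e : E) : G.St R e * G.Se R e = G.Pg R (G.rng e) :=
  (map_mul (RingQuot.mkAlgHom R (LeavittRel R G)) _ _).symm.trans
    (RingQuot.mkAlgHom_rel R (LeavittRel.ghost_edge (R := R) e))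

theorem Pg_ck (v : V) (hfin : {e : E | G.s e = v}.Finite)
    (hne : {e : E | G.s e = v}.Nonempty) :
    G.Pg R (G.vtx v) = ∑ e ∈ hfin.toFinset, G.Se R e * G.St R e := by
  refine (RingQuot.mkAlgHom_rel R (LeavittRel.ck (R := R) v hfin hne)).trans ?_
  rw [map_sum]
  refine Finset.sum_congr rfl fun e _ => ?_
  rw [map_mul]
  rfl

end Rels

section Main

variable {V : Type u} {E : Type v} {G : Ultragraph V E} {R : Type w} [CommRing R]
  {N : Type x} [AddCommGroup N] [Module R N]
  {φ : LeavittAlgebra R G →ₐ[R] Module.End R N}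

theorem phi_mul (a b : LeavittAlgebra R G) (n : N) : φ (a * b) n = φ a (φ b n) := by
  rw [map_mul]; rfl

theorem Br_fix (P : PermutativeData G R φ) {e : E} {h : N} (hh : h ∈ P.Br e) :
    φ (G.Pg R (G.rng e)) h = h := by
  obtain ⟨n, rfl⟩ := (P.hBr e).1 hh
  rw [← phi_mul, Pg_mul]
  congr 4
  exact Subtype.ext (Set.inter_self _)

theorem Bv_fix (P : PermutativeData G R φ) {v : V} {h : N} (hh : h ∈ P.Bv v) :
    φ (G.Pg R (G.vtx v)) h = h := by
  obtain ⟨n, rfl⟩ := (P.hBv v).1 hh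
  rw [← phi_mul, Pg_mul]
  congr 4
  exact Subtype.ext (Set.inter_self _)

variable (P : PermutativeData G R φ)

theorem Bv_zero
    (h1 : ∀ (A : Set V) (hA : G.IsG0 A) (d : G0Desc G A),
      ∀ h ∈ P.B \ BAset R P d, φ (G.Pg R ⟨A, hA⟩) h = 0)
    {v : V} {h : N} (hB : h ∈ P.B) (hh : h ∉ P.Bv v) :
    φ (G.Pg R (G.vtx v)) h = 0 := by
  refine h1 {v} (IsG0.singleton v) ⟨0, fun _ => ∅, fun i => i.elim0, {v}, by simp⟩ h ⟨hB, ?_⟩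
  simpa [BAset] using hh

theorem Br_zero
    (h1 : ∀ (A : Set V) (hA : G.IsG0 A) (d : G0Desc G A),
      ∀ h ∈ P.B \ BAset R P d, φ (G.Pg R ⟨A, hA⟩) h = 0)
    {e : E} {h : N} (hB : h ∈ P.B) (hh : h ∉ P.Br e) :
    φ (G.Pg R (G.rng e)) h = 0 := by
  refine h1 (G.r e) (IsG0.range e) ⟨1, fun _ => {e}, fun i => by simp, ∅,
    by simp [Set.iUnion_const]⟩ h ⟨hB, ?_⟩
  simpa [BAset, Set.iUnion_const] using hh

theorem union_apply (A B : G.G0) (h : N) : φ (G.Pg R (G.unionG0 A B)) h =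
    φ (G.Pg R A) h + φ (G.Pg R B) h - φ (G.Pg R A) (φ (G.Pg R B) h) := by
  rw [Pg_union, ← Pg_mul, map_sub, map_add, map_mul]; rfl

theorem proj_cases
    (h1 : ∀ (A : Set V) (hA : G.IsG0 A) (d : G0Desc G A),
      ∀ h ∈ P.B \ BAset R P d, φ (G.Pg R ⟨A, hA⟩) h = 0)
    {A : Set V} (hA : G.IsG0 A) {h : N} (hB : h ∈ P.B) :
    φ (G.Pg R ⟨A, hA⟩) h = h ∨ φ (G.Pg R ⟨A, hA⟩) h = 0 := by
  induction hA with
  | empty =>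
    right
    have := Pg_empty G R
    unfold emptyG0 at this
    rw [this, map_zero]; rfl
  | singleton v =>
    by_cases hv : h ∈ P.Bv v
    · exact Or.inl (Bv_fix P hv)
    · exact Or.inr (Bv_zero P h1 hB hv)
  | range e =>
    by_cases hv : h ∈ P.Br e
    · exact Or.inl (Br_fix P hv)
    · exact Or.inr (Br_zero P h1 hB hv)
  | @union A B hA hB ihA ihB =>
    have := union_apply (φ := φ) ⟨A, hA⟩ ⟨B, hB⟩ h
    unfold unionG0 at this
    rw [this]
    rcases ihA with a | a <;> rcases ihB with b | b <;> simp [a, b]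
  | @inter A B hA hB ihA ihB =>
    have := Pg_mul G R ⟨A, hA⟩ ⟨B, hB⟩
    unfold interG0 at this
    rw [← this, phi_mul]
    rcases ihA with a | a <;> rcases ihB with b | b <;> simp [a, b]

theorem Be_fix {e : E} {h : N} (hh : h ∈ P.Be e) :
    φ (G.Se R e) (φ (G.St R e) h) = h := by
  rw [← P.hmap e] at hh
  obtain ⟨b, hb, rfl⟩ := hh
  rw [← phi_mul (G.St R e), St_Se, Br_fix P hb]

theorem St_mem {e : E} {h : N} (hh : h ∈ P.Be e) : φ (G.St R e) h ∈ P.Br e := by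
  rw [← P.hmap e] at hh
  obtain ⟨b, hb, rfl⟩ := hh
  rwa [← phi_mul, St_Se, Br_fix P hb]

theorem Se_mem {e : E} {h : N} (hh : h ∈ P.Br e) : φ (G.Se R e) h ∈ P.Be e :=
  P.hmap e ▸ Set.mem_image_of_mem _ hh

theorem St_Se_fix {e : E} {h : N} (hh : h ∈ P.Br e) :
    φ (G.St R e) (φ (G.Se R e) h) = h := by
  rw [← phi_mul, St_Se, Br_fix P hh]

theorem Be_B {e : E} {h : N} (hh : h ∈ P.Be e) : h ∈ P.B := P.hBvB _ (P.hBeBv e hh)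

theorem B_ne_zero [Nontrivial R] {h : N} (hh : h ∈ P.B) : h ≠ 0 :=
  P.hB.1.ne_zero ⟨h, hh⟩

theorem mem_Br_iff [Nontrivial R]
    (h1 : ∀ (A : Set V) (hA : G.IsG0 A) (d : G0Desc G A),
      ∀ h ∈ P.B \ BAset R P d, φ (G.Pg R ⟨A, hA⟩) h = 0)
    {e : E} {h : N} (hB : h ∈ P.B) :
    φ (G.Pg R (G.rng e)) h = h ↔ h ∈ P.Br e := by
  refine ⟨fun hh => ?_, Br_fix P⟩
  by_contra hn
  exact B_ne_zero P hB (hh.symm.trans (Br_zero P h1 hB hn))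

/-- The branching system on the set `X = B`. -/
noncomputable def permBS [Nontrivial R]
    (h1 : ∀ (A : Set V) (hA : G.IsG0 A) (d : G0Desc G A),
      ∀ h ∈ P.B \ BAset R P d, φ (G.Pg R ⟨A, hA⟩) h = 0)
    (h2 : ∀ e : E, ∀ h ∈ P.B \ P.Be e, φ (G.St R e) h = 0) : BranchingSystem G P.B where
  Re e := {y | (y : N) ∈ P.Be e}
  D A := {y | φ (G.Pg R A) (y : N) = y}
  disj e f hef := by
    ext ⟨y, hy⟩
    simp only [Set.mem_inter_iff, Set.mem_ofPred_eq, Set.mem_empty_iff_false, iff_false, not_and]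
    intro he hf
    apply B_ne_zero P hy
    rw [← Be_fix P he]
    nth_rewrite 1 [← Be_fix P hf]
    rw [← phi_mul (G.St R e), St_Se_ne G R hef]
    simp
  D_empty := by
    ext ⟨y, hy⟩
    simp only [Set.mem_ofPred_eq, Set.mem_empty_iff_false, iff_false, Pg_empty, map_zero]
    exact fun h => B_ne_zero P hy h.symm
  D_inter A B := by
    ext ⟨y, hy⟩
    have h0 := B_ne_zero P hy
    simp only [Set.mem_inter_iff, Set.mem_ofPred_eq, ← Pg_mul, phi_mul]
    rcases proj_cases P h1 A.2 hy with a | a <;> rcases proj_cases P h1 B.2 hy with b | b <;>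
      change φ (G.Pg R A) y = _ at a <;> change φ (G.Pg R B) y = _ at b <;>
      simp [a, b, h0.symm]
  D_union A B := by
    ext ⟨y, hy⟩
    have h0 := B_ne_zero P hy
    simp only [Set.mem_union, Set.mem_ofPred_eq, union_apply]
    rcases proj_cases P h1 A.2 hy with a | a <;> rcases proj_cases P h1 B.2 hy with b | b <;>
      change φ (G.Pg R A) y = _ at a <;> change φ (G.Pg R B) y = _ at b <;>
      simp [a, b, h0.symm]
  Re_subset e := fun y hy => Bv_fix P (P.hBeBv e hy)
  D_vtx v hfin hne := by
    ext ⟨y, hy⟩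
    simp only [Set.mem_ofPred_eq, Set.mem_iUnion, exists_prop]
    constructor
    · intro h
      by_contra! hn
      apply B_ne_zero P hy
      rw [← h, Pg_ck G R v hfin hne, map_sum, LinearMap.sum_apply]
      refine Finset.sum_eq_zero fun e he => ?_
      rw [phi_mul, h2 e y ⟨hy, hn e (by simpa using he)⟩, map_zero]
    · rintro ⟨e, rfl, he⟩
      exact Bv_fix P (P.hBeBv e he)
  fe e :=
    { toFun := fun y => ⟨⟨φ (G.Se R e) (y : P.B), Be_B P
          (Se_mem P ((mem_Br_iff P h1 y.1.2).1 y.2))⟩,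
          Se_mem P ((mem_Br_iff P h1 y.1.2).1 y.2)⟩
      invFun := fun y => ⟨⟨φ (G.St R e) (y : P.B), P.hBrB e (St_mem P y.2)⟩,
          Br_fix P (St_mem P y.2)⟩
      left_inv := fun y => Subtype.ext (Subtype.ext
          (St_Se_fix P ((mem_Br_iff P h1 y.1.2).1 y.2)))
      right_inv := fun y => Subtype.ext (Subtype.ext (Be_fix P y.2)) }

end Main

end Ultragraph

open Ultragraph in
/-- A permutative representation `φ` with `φ(p_A)` vanishing on `B ∖ B_A` and `φ(s_e*)`
vanishing on `B ∖ B_e` is equivalent to the representation induced by some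
`𝒢`-algebraic branching system on the module of finitely supported functions. -/
theorem permutative_equivalent_branchingSystem {V : Type u} {E : Type v}
    (G : Ultragraph V E) (R : Type w) [CommRing R]
    {N : Type x} [AddCommGroup N] [Module R N]
    (φ : LeavittAlgebra R G →ₐ[R] Module.End R N) (P : PermutativeData G R φ)
    (h1 : ∀ (A : Set V) (hA : G.IsG0 A) (d : G0Desc G A),
      ∀ h ∈ P.B \ BAset R P d, φ (G.Pg R ⟨A, hA⟩) h = 0)
    (h2 : ∀ e : E, ∀ h ∈ P.B \ P.Be e, φ (G.St R e) h = 0) :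
    ∃ (X : Type x) (Bs : G.BranchingSystem X)
      (π : LeavittAlgebra R G →ₐ[R] Module.End R (X →₀ R)),
      IsInducedRepF G R Bs π ∧
      ∃ T : (X →₀ R) ≃ₗ[R] N,
        ∀ (a : LeavittAlgebra R G) (m : X →₀ R), T (π a m) = φ a (T m) := by
  classical
  rcases subsingleton_or_nontrivial R with hR | hR
  · have hN : Subsingleton N := Module.subsingleton R N
    let T : (PEmpty.{x + 1} →₀ R) ≃ₗ[R] N := 0
    refine ⟨PEmpty.{x + 1}, ⟨fun _ => ∅, fun _ => ∅, ?_, rfl, ?_, ?_, ?_, ?_, fun _ => Equiv.refl _⟩,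
      ((T.symm.conjAlgEquiv R : _ →ₐ[R] _)).comp φ, ⟨?_, ?_, ?_⟩, T, fun a m => Subsingleton.elim _ _⟩
    · intros; simp
    · intros; simp
    · intros; simp
    · intros; simp
    · intros; simp
    · intro _ _ y; exact y.elim
    · intro _ _ y; exact y.elim
    · intro _ _ y; exact y.elim
  · let b : Module.Basis P.B R N := Module.Basis.mk P.hB.1 (by
      rw [Subtype.range_coe]; exact P.hB.2.ge)
    have hb : ∀ y : P.B, b y = y := fun y => Module.Basis.mk_apply _ _ y
    let T : (P.B →₀ R) ≃ₗ[R] N := b.repr.symm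
    let π : LeavittAlgebra R G →ₐ[R] Module.End R (P.B →₀ R) :=
      ((T.symm.conjAlgEquiv R : _ →ₐ[R] _)).comp φ
    have hπ : ∀ a m, π a m = b.repr (φ a (b.repr.symm m)) := fun a m => rfl
    have hs : ∀ a (y : P.B), π a (Finsupp.single y 1) = b.repr (φ a y) := fun a y => by
      rw [hπ, Module.Basis.repr_symm_single_one, hb]
    have hr : ∀ y : P.B, b.repr (y : N) = Finsupp.single y 1 := fun y => by
      rw [← hb y, b.repr_self]
    -- two functionals agreeing on the canonical basis agree
    have key : ∀ (L L' : (P.B →₀ R) →ₗ[R] R),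
        (∀ y, L (Finsupp.single y 1) = L' (Finsupp.single y 1)) → ∀ m, L m = L' m := by
      intro L L' h m
      have : L = L' := Finsupp.lhom_ext' fun y => LinearMap.ext_ring (h y)
      rw [this]
    refine ⟨P.B, permBS P h1 h2, π, ⟨?_, ?_, ?_⟩, T, fun a m => T.apply_symm_apply _⟩
    · intro e m y
      have := key (Finsupp.lapply y ∘ₗ π (G.Se R e))
        (if h : y ∈ (permBS P h1 h2).Re e then
          Finsupp.lapply (((permBS P h1 h2).fe e).symm ⟨y, h⟩ : P.B) else 0) ?_ m
      · refine this.trans ?_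
        split_ifs <;> rfl
      · intro z
        rw [LinearMap.comp_apply, hs]
        by_cases hz : (z : N) ∈ P.Br e
        · have h3 := hr ⟨φ (G.Se R e) z, Be_B P (Se_mem P hz)⟩
          simp only at h3
          rw [h3]
          split_ifs with h
          · simp only [Finsupp.lapply_apply, Finsupp.single_apply]
            refine if_congr ⟨?_, ?_⟩ rfl rfl
            · intro hh
              subst hh
              exact Subtype.ext (St_Se_fix P hz).symm
            · intro hh
              exact Subtype.ext ((congrArg (fun t : P.B => φ (G.Se R e) (t : N)) hh).trans
                (Be_fix P h))
          · simp only [Finsupp.lapply_apply, LinearMap.zero_apply]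
            refine Finsupp.single_eq_of_ne ?_
            rintro rfl
            exact h (Se_mem P hz)
        · have h3 : φ (G.Se R e) z = 0 := by
            rw [← Se_rng, phi_mul, Br_zero P h1 z.2 hz, map_zero]
          rw [h3, map_zero, map_zero]
          split_ifs with h
          · simp only [Finsupp.lapply_apply]
            refine (Finsupp.single_eq_of_ne ?_).symm
            rintro rfl
            exact hz (St_mem P h)
          · rfl
    · intro e m y
      have := key (Finsupp.lapply y ∘ₗ π (G.St R e))
        (if h : y ∈ (permBS P h1 h2).D (G.rng e) then
          Finsupp.lapply ((permBS P h1 h2).fe e ⟨y, h⟩ : P.B) else 0) ?_ m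
      · refine this.trans ?_
        split_ifs <;> rfl
      · intro z
        rw [LinearMap.comp_apply, hs]
        by_cases hz : (z : N) ∈ P.Be e
        · have h3 := hr ⟨φ (G.St R e) z, P.hBrB e (St_mem P hz)⟩
          simp only at h3
          rw [h3]
          split_ifs with h
          · have h' := (mem_Br_iff P h1 y.2).1 h
            simp only [Finsupp.lapply_apply, Finsupp.single_apply]
            refine if_congr ⟨?_, ?_⟩ rfl rfl
            · intro hh
              subst hh
              exact Subtype.ext (Be_fix P hz).symm
            · intro hh
              exact Subtype.ext ((congrArg (fun t : P.B => φ (G.St R e) (t : N)) hh).trans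
                (St_Se_fix P h'))
          · simp only [Finsupp.lapply_apply, LinearMap.zero_apply]
            refine Finsupp.single_eq_of_ne ?_
            rintro rfl
            exact h (Br_fix P (St_mem P hz))
        · rw [h2 e z ⟨z.2, hz⟩, map_zero, map_zero]
          split_ifs with h
          · simp only [Finsupp.lapply_apply]
            refine (Finsupp.single_eq_of_ne ?_).symm
            rintro rfl
            exact hz (Se_mem P ((mem_Br_iff P h1 y.2).1 h))
          · rfl
    · intro A m y
      have := key (Finsupp.lapply y ∘ₗ π (G.Pg R A))
        (if y ∈ (permBS P h1 h2).D A then Finsupp.lapply y else 0) ?_ m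
      · refine this.trans ?_
        split_ifs <;> rfl
      · intro z
        rw [LinearMap.comp_apply, hs]
        by_cases hz : φ (G.Pg R A) z = z
        · rw [hz, hr]
          split_ifs with h
          · rfl
          · refine Finsupp.single_eq_of_ne ?_
            rintro rfl
            exact h hz
        · have h3 : φ (G.Pg R A) z = 0 := (proj_cases P h1 A.2 z.2).resolve_left hz
          rw [h3, map_zero, map_zero]
          split_ifs with h
          · refine (Finsupp.single_eq_of_ne ?_).symm
            rintro rfl
            exact hz h
          · rfl
end

section
/- Let 𝒢 be an ultragraph, R a unital commutative ring, N an R-module, and φ : L_R(𝒢) → Hom_R(N) a permutative representation with associated bases B, B_v, B_{r(e)}, B_e. Suppose that φ(p_A)(h) = 0 for every A ∈ 𝒢⁰ and every h ∈ B∖B_A. Then for every edge e ∈ 𝒢¹ such that v = s(e) satisfies 0 < |s⁻¹(v)| < ∞, one has φ(s_e*)(h) = 0 for every h ∈ B∖B_e. -/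
universe u v w

universe x

theorem Ultragraph.St_mul_Pg_src {V : Type u} {E : Type v} (G : Ultragraph V E) (R : Type w)
    [CommRing R] (e : E) : G.St R e * G.Pg R (G.vtx (G.s e)) = G.St R e := by
  have := RingQuot.mkAlgHom_rel R (Ultragraph.LeavittRel.ghost_src (R := R) (G := G) e)
  rw [map_mul] at this
  exact this

theorem Ultragraph.St_mul_Se_ne {V : Type u} {E : Type v} (G : Ultragraph V E) (R : Type w)
    [CommRing R] {e f : E} (hef : e ≠ f) : G.St R e * G.Se R f = 0 := by
  have := RingQuot.mkAlgHom_rel R (Ultragraph.LeavittRel.ghost_edge_ne (R := R) (G := G) hef)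
  rw [map_mul, map_zero] at this
  exact this

theorem Ultragraph.Pg_mul_self {V : Type u} {E : Type v} (G : Ultragraph V E) (R : Type w)
    [CommRing R] (v : V) :
    G.Pg R (G.vtx v) * G.Pg R (G.vtx v) = G.Pg R (G.vtx v) := by
  have := RingQuot.mkAlgHom_rel R
    (Ultragraph.LeavittRel.p_mul (R := R) (G := G) (G.vtx v) (G.vtx v))
  have h2 : G.interG0 (G.vtx v) (G.vtx v) = G.vtx v := Subtype.ext (Set.inter_self _)
  rw [map_mul, h2] at this
  exact this

theorem Ultragraph.Pg_eq_sum {V : Type u} {E : Type v} (G : Ultragraph V E) (R : Type w)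
    [CommRing R] (v : V) (hfin : {e : E | G.s e = v}.Finite)
    (hne : {e : E | G.s e = v}.Nonempty) :
    G.Pg R (G.vtx v) = ∑ e ∈ hfin.toFinset, G.Se R e * G.St R e := by
  have := RingQuot.mkAlgHom_rel R (Ultragraph.LeavittRel.ck (R := R) (G := G) v hfin hne)
  rw [map_sum] at this
  simp only [map_mul] at this
  exact this

open Ultragraph in
/-- If a permutative representation `φ` satisfies `φ(p_A)(h) = 0` for all `h ∈ B ∖ B_A`,
then for every edge `e` whose source is a finite emitter, `φ(s_e*)(h) = 0` for all
`h ∈ B ∖ B_e`. -/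
theorem ghost_vanishes_of_proj_vanishes {V : Type u} {E : Type v}
    (G : Ultragraph V E) (R : Type w) [CommRing R]
    {N : Type x} [AddCommGroup N] [Module R N]
    (φ : LeavittAlgebra R G →ₐ[R] Module.End R N) (P : PermutativeData G R φ)
    (h1 : ∀ (A : Set V) (hA : G.IsG0 A) (d : G0Desc G A),
      ∀ h ∈ P.B \ BAset R P d, φ (G.Pg R ⟨A, hA⟩) h = 0) :
    ∀ e : E, {f : E | G.s f = G.s e}.Finite →
      ∀ h ∈ P.B \ P.Be e, φ (G.St R e) h = 0 := by
  intro e hfin h hh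
  obtain ⟨hB, hBe⟩ := hh
  rcases subsingleton_or_nontrivial R with hR | hR
  · haveI : Subsingleton N := Module.subsingleton R N
    exact Subsingleton.elim _ _
  by_cases hv : h ∈ P.Bv (G.s e)
  · have hp : φ (G.Pg R (G.vtx (G.s e))) h = h := by
      obtain ⟨y, hy⟩ := (P.hBv (G.s e)).1 hv
      rw [← hy, ← Module.End.mul_apply, ← map_mul, G.Pg_mul_self]
    have hspan : h ∈ Submodule.span R (⋃ f ∈ {f : E | G.s f = G.s e}, P.Be f) := by
      rw [← hp, G.Pg_eq_sum R _ hfin ⟨e, rfl⟩, map_sum, LinearMap.sum_apply]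
      refine Submodule.sum_mem _ fun f hf => ?_
      have hf' : G.s f = G.s e := by simpa using hf
      have : φ (G.Se R f * G.St R f) h ∈ Submodule.span R (P.Be f) := by
        rw [(P.hBe f).2.2]
        exact ⟨h, rfl⟩
      exact Submodule.span_mono (Set.subset_biUnion_of_mem (u := P.Be) hf') this
    have hmem : h ∈ ⋃ f ∈ {f : E | G.s f = G.s e}, P.Be f := by
      by_contra hcon
      have hsub : (⋃ f ∈ {f : E | G.s f = G.s e}, P.Be f) ⊆ P.B :=
        Set.iUnion₂_subset fun f _ => (P.hBeBv f).trans (P.hBvB _)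
      have key := P.hB.1.notMem_span_image (s := Subtype.val ⁻¹'
        (⋃ f ∈ {f : E | G.s f = G.s e}, P.Be f)) (x := ⟨h, hB⟩) hcon
      rw [Subtype.image_preimage_coe, Set.inter_eq_right.mpr hsub] at key
      exact key hspan
    obtain ⟨f, hf, hhf⟩ := Set.mem_iUnion₂.mp hmem
    have hef : e ≠ f := by
      rintro rfl
      exact hBe hhf
    rw [← P.hmap f] at hhf
    obtain ⟨k, -, rfl⟩ := hhf
    rw [← Module.End.mul_apply, ← map_mul, G.St_mul_Se_ne R hef, map_zero]
    rfl
  · have h0 := h1 {G.s e} (IsG0.singleton _)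
      { n := 0, Xs := fun i => i.elim0, hXs := fun i => i.elim0, F := {G.s e}, eq := by simp }
      h ⟨hB, by simpa [BAset] using hv⟩
    rw [← G.St_mul_Pg_src, map_mul, Module.End.mul_apply]
    have h0' : φ (G.Pg R (G.vtx (G.s e))) h = 0 := h0
    rw [h0', map_zero]
end
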